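/- arXiv:1606.07844 — 2 statements merged into one kernel-verified Lean document; each statement's English description precedes it below -/
import Mathlib

section
/- Let p be an odd prime and r ≥ 1 an integer, and let h_p denote the class number of the imaginary quadratic field ℚ(√−p). Then ∑_{x=1}^{2p^r} {−x²/(4p^r)} = p^r − {p^r/4} · p^⌊r/2⌋ + ((p^⌊(r+1)/2⌋ − 1)/(2(p − 1))) · c, where c = h_p if p ≡ 1 (mod 4), c = 4·h_p^* + 1 if p ≡ 3 (mod 8), and c = 2·h_p + 1 if p ≡ 7 (mod 8); here h_p^* := −∑_{a=0}^{p−1} (a|p) · (a/p), and moreover h_p^* = h_p whenever p ≡ 3 (mod 8) and p ≠ 3, while h_3^* = 1/3. -/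
/-- `h_p^* = -∑_{a=0}^{p-1} (a|p)·(a/p)`, where `(a|p)` is the Legendre symbol. -/
def hpStar (p : ℕ) [Fact p.Prime] : ℚ :=
  -∑ a ∈ Finset.range p, (legendreSym p a : ℚ) * ((a : ℚ) / p)

lemma A_shift (n : ℕ) (f : ℤ → ℚ) (hf : ∀ k, f (k + n) = f k) (k : ℤ) :
    ∑ j ∈ Finset.range n, f (k + j) = ∑ j ∈ Finset.range n, f j := by
  have step : ∀ k : ℤ, ∑ j ∈ Finset.range n, f (k + 1 + j) = ∑ j ∈ Finset.range n, f (k + j) := by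
    intro k
    have h1 := Finset.sum_range_succ (fun j : ℕ => f (k + j)) n
    have h2 := Finset.sum_range_succ' (fun j : ℕ => f (k + j)) n
    rw [h1] at h2
    simp only [hf, Nat.cast_zero, add_zero] at h2
    have h3 := add_right_cancel h2
    rw [h3]
    refine Finset.sum_congr rfl fun j _ => ?_
    congr 1; push_cast; ring
  induction k using Int.induction_on with
  | zero => simp
  | succ i ih => rw [step, ih]
  | pred i ih => rw [← ih, ← step (-(i:ℤ) - 1)]; simp

lemma A_period (n : ℕ) (f : ℤ → ℚ) (hf : ∀ k, f (k + n) = f k) (k m : ℤ) : f (k + n * m) = f k := by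
  induction m using Int.induction_on with
  | zero => simp
  | succ i ih => rw [mul_add, ← add_assoc, mul_one, hf, ih]
  | pred i ih => rw [← ih, ← hf]; congr 1; ring

lemma A_zmod (n : ℕ) [NeZero n] (f : ℤ → ℚ) :
    ∑ j ∈ Finset.range n, f j = ∑ a : ZMod n, f a.val := by
  refine Finset.sum_bij' (fun j _ => (j : ZMod n)) (fun a _ => a.val) ?_ ?_ ?_ ?_ ?_
  · simp
  · intro a _; simpa using ZMod.val_lt a
  · intro j hj; exact ZMod.val_cast_of_lt (by simpa using hj)
  · intro a _; simp
  · intro j hj; rw [ZMod.val_cast_of_lt (by simpa using hj)]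

lemma A_congr (n : ℕ) (f : ℤ → ℚ) (hf : ∀ k, f (k + n) = f k) (k l : ℤ)
    (h : (k : ZMod n) = l) : f k = f l := by
  rw [ZMod.intCast_eq_intCast_iff_dvd_sub] at h
  obtain ⟨c, hc⟩ := h
  rw [show l = k + n * c by linarith, A_period n f hf]

lemma A_mulunit (p : ℕ) [Fact p.Prime] (f : ℤ → ℚ) (hf : ∀ k, f (k + p) = f k) (u : ℤ)
    (hu : (u : ZMod p) ≠ 0) :
    ∑ j ∈ Finset.range p, f (u * j) = ∑ j ∈ Finset.range p, f j := by
  rw [A_zmod p f, A_zmod p (fun j => f (u * j))]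
  refine Fintype.sum_equiv (Equiv.mulLeft₀ (u : ZMod p) hu) _ _ ?_
  intro a
  apply A_congr p f hf
  simp

lemma A_block (m n : ℕ) (f : ℕ → ℚ) :
    ∑ y ∈ Finset.range (m * n), f y =
      ∑ i ∈ Finset.range m, ∑ j ∈ Finset.range n, f (i + m * j) := by
  induction n with
  | zero => simp
  | succ n ih =>
    rw [mul_add, mul_one, Finset.sum_range_add, ih, ← Finset.sum_add_distrib]
    refine Finset.sum_congr rfl fun i _ => ?_
    rw [Finset.sum_range_succ, add_comm i (m * n)]

lemma A_fract_small (n : ℕ) (hn : 0 < n) (m : ℕ) (hm : m < n) (e : ℚ) (h0 : 0 ≤ e) (h1 : e < 1) :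
    Int.fract (((m : ℚ) + e) / n) = ((m : ℚ) + e) / n := by
  have hn' : (0:ℚ) < n := by exact_mod_cast hn
  rw [Int.fract_eq_self]
  refine ⟨by positivity, ?_⟩
  rw [div_lt_one hn']
  have : (m : ℚ) + 1 ≤ n := by exact_mod_cast hm
  linarith

lemma A_dist (n : ℕ) (hn : 0 < n) (x : ℚ) :
    ∑ j ∈ Finset.range n, Int.fract (x + (j : ℚ) / n) = Int.fract (n * x) + ((n : ℚ) - 1) / 2 := by
  have hn' : (n : ℚ) ≠ 0 := by positivity
  set e := Int.fract (n * x) with he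
  set k := ⌊(n : ℚ) * x⌋ with hk
  have hx : (n : ℚ) * x = k + e := (Int.floor_add_fract _).symm
  have hper : ∀ l : ℤ, Int.fract ((((l + n : ℤ) : ℚ) + e) / n) = Int.fract (((l : ℚ) + e) / n) := by
    intro l
    rw [← Int.fract_add_one (((l : ℚ) + e) / n)]
    congr 1; push_cast; field_simp; ring
  have := A_shift n (fun l : ℤ => Int.fract (((l : ℚ) + e) / n)) hper k
  calc _ = ∑ j ∈ Finset.range n, Int.fract ((((k + j : ℤ) : ℚ) + e) / n) := by
        refine Finset.sum_congr rfl fun j _ => ?_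
        congr 1; push_cast; field_simp; linarith
    _ = ∑ j ∈ Finset.range n, Int.fract ((((j : ℤ) : ℚ) + e) / n) := this
    _ = ∑ j ∈ Finset.range n, ((j : ℚ) + e) / n := by
        refine Finset.sum_congr rfl fun j hj => ?_
        have := A_fract_small n hn j (by simpa using hj) e (Int.fract_nonneg _) (Int.fract_lt_one _)
        simpa using this
    _ = _ := by
        rw [← Finset.sum_div, Finset.sum_add_distrib]
        have h2 : (∑ j ∈ Finset.range n, (j : ℚ)) = n * (n - 1) / 2 := by
          clear * -
          induction n with
          | zero => simp
          | succ n ih => rw [Finset.sum_range_succ, ih]; push_cast; ring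
        rw [h2]; simp; field_simp; ring

/-- distribution with unit multiplier -/
lemma A_dist_unit (p : ℕ) [Fact p.Prime] (x : ℚ) (u : ℤ) (hu : (u : ZMod p) ≠ 0) :
    ∑ j ∈ Finset.range p, Int.fract (x + (u * j : ℚ) / p) = Int.fract (p * x) + ((p : ℚ) - 1) / 2 := by
  have hp : 0 < p := (Fact.out : p.Prime).pos
  have hp' : (p : ℚ) ≠ 0 := by positivity
  rw [← A_dist p hp x]
  have := A_mulunit p (fun l : ℤ => Int.fract (x + (l : ℚ) / p)) (by
    intro l
    rw [← Int.fract_add_one (x + (l : ℚ) / p)]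
    congr 1; push_cast; field_simp; ring) u hu
  simpa using this

/-- unit part -/
def AT (p r : ℕ) (t : ℚ) : ℚ :=
  ∑ y ∈ Finset.range (p ^ r), if p ∣ y then 0 else Int.fract (t - (y : ℚ) ^ 2 / (p : ℚ) ^ r)

def AS (p r : ℕ) (t : ℚ) : ℚ :=
  ∑ y ∈ Finset.range (p ^ r), Int.fract (t - (y : ℚ) ^ 2 / (p : ℚ) ^ r)

lemma A_count (p r : ℕ) (hp : 0 < p) : ∑ y ∈ Finset.range (p ^ (r + 1)), (if p ∣ y then (0:ℚ) else 1) =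
    (p : ℚ) ^ (r + 1) - p ^ r := by
  rw [pow_succ', A_block]
  obtain ⟨q, rfl⟩ : ∃ q, p = q + 1 := ⟨p - 1, by omega⟩
  rw [Finset.sum_range_succ']
  have : ∀ i ∈ Finset.range q, ∑ j ∈ Finset.range ((q+1) ^ r), (if (q + 1) ∣ (i + 1) + (q + 1) * j then (0:ℚ) else 1)
      = ((q + 1 : ℕ) : ℚ) ^ r := by
    intro i hi
    have hh : ∀ j, ¬ (q + 1) ∣ (i + 1) + (q + 1) * j := by
      intro j h
      rw [Nat.dvd_add_left (dvd_mul_right _ _)] at h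
      have := Nat.le_of_dvd (by omega) h
      simp at hi; omega
    simp [hh]
  rw [Finset.sum_congr rfl this]
  simp
  ring

lemma AT_step (p : ℕ) [Fact p.Prime] (hodd : Odd p) (r : ℕ) (t : ℚ) :
    AT p (r + 2) t = AT p (r + 1) (p * t) + ((p : ℚ) - 1) / 2 * ((p : ℚ) ^ (r + 1) - p ^ r) := by
  have hpr : p.Prime := Fact.out
  have hp : 0 < p := hpr.pos
  have hp' : (p : ℚ) ≠ 0 := by positivity
  rw [← A_count p r hp, Finset.mul_sum]
  unfold AT
  rw [← Finset.sum_add_distrib, pow_succ p (r + 1), A_block]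
  refine Finset.sum_congr rfl fun y _ => ?_
  by_cases hy : p ∣ y
  · have : ∀ j, p ∣ y + p ^ (r + 1) * j := fun j =>
      dvd_add hy (dvd_mul_of_dvd_left (dvd_pow_self p (by omega)) _)
    simp [this, hy]
  · have : ∀ j, ¬ p ∣ y + p ^ (r + 1) * j := fun j h =>
      hy ((Nat.dvd_add_left (dvd_mul_of_dvd_left (dvd_pow_self p (by omega)) _)).1 h)
    simp only [this, hy, if_false, mul_one]
    have hu : ((-2 * y : ℤ) : ZMod p) ≠ 0 := by
      rw [Ne, ZMod.intCast_zmod_eq_zero_iff_dvd]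
      intro h
      have h2 : (p : ℤ) ∣ 2 * y := by
        have := h; rwa [neg_mul, dvd_neg] at this
      have h3 : p ∣ 2 * y := by exact_mod_cast h2
      rcases hpr.dvd_mul.1 h3 with h | h
      · have := Nat.le_of_dvd (by norm_num) h
        have := hpr.two_le
        obtain ⟨k, hk⟩ := hodd
        omega
      · exact hy h
    have key := A_dist_unit p (t - (y : ℚ) ^ 2 / (p : ℚ) ^ (r + 2)) (-2 * y) hu
    rw [show (p : ℚ) * (t - (y : ℚ) ^ 2 / (p : ℚ) ^ (r + 2)) = p * t - (y : ℚ) ^ 2 / (p : ℚ) ^ (r + 1) by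
      field_simp; ring] at key
    rw [← key]
    refine Finset.sum_congr rfl fun j _ => ?_
    rw [Int.fract_eq_fract]
    refine ⟨- (p ^ r * j ^ 2 : ℕ), ?_⟩
    push_cast
    field_simp
    ring

lemma AS_eq_AT_one (p : ℕ) [Fact p.Prime] (t : ℚ) : AS p 1 t = AT p 1 t + Int.fract t := by
  have hp : 0 < p := (Fact.out : p.Prime).pos
  unfold AS AT
  obtain ⟨q, rfl⟩ : ∃ q, p = q + 1 := ⟨p - 1, by omega⟩
  rw [pow_one, Finset.sum_range_succ', Finset.sum_range_succ']
  simp only [Nat.cast_zero, dvd_zero, if_true]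
  have : ∀ i ∈ Finset.range q, ¬ (q + 1) ∣ i + 1 := by
    intro i hi h
    have := Nat.le_of_dvd (by omega) h
    simp at hi; omega
  rw [Finset.sum_congr (s₁ := Finset.range q) rfl (f := fun x => if (q + 1) ∣ x + 1 then (0 : ℚ) else Int.fract (t - ((x + 1 : ℕ) : ℚ) ^ 2 / ((q + 1 : ℕ) : ℚ) ^ 1)) (fun i hi => if_neg (this i hi))]
  simp

lemma AS_step (p : ℕ) [Fact p.Prime] (r : ℕ) (t : ℚ) :
    AS p (r + 2) t = AT p (r + 2) t + p * AS p r t := by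
  have hp : 0 < p := (Fact.out : p.Prime).pos
  have hp' : (p : ℚ) ≠ 0 := by positivity
  have h1 : AS p (r + 2) t - AT p (r + 2) t =
    ∑ y ∈ Finset.range (p ^ (r + 2)), if p ∣ y then Int.fract (t - (y : ℚ) ^ 2 / (p : ℚ) ^ (r + 2)) else 0 := by
    unfold AS AT
    rw [← Finset.sum_sub_distrib]
    refine Finset.sum_congr rfl fun y _ => ?_
    split_ifs <;> simp
  rw [← sub_eq_iff_eq_add', h1, pow_succ' p (r + 1), A_block]
  obtain ⟨q, hq⟩ : ∃ q, p = q + 1 := ⟨p - 1, by omega⟩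
  have h0 : ∀ i ∈ Finset.range p, i ≠ 0 → ∑ j ∈ Finset.range (p ^ (r + 1)), (if p ∣ i + p * j then Int.fract (t - ((i + p * j : ℕ) : ℚ) ^ 2 / (p : ℚ) ^ (r + 2)) else 0) = 0 := by
    intro i hi h0
    refine Finset.sum_eq_zero fun j _ => ?_
    rw [if_neg]
    intro h
    rw [Nat.dvd_add_left (dvd_mul_right _ _)] at h
    have := Nat.le_of_dvd (by omega) h
    simp at hi; omega
  rw [Finset.sum_eq_single_of_mem 0 (by simpa using hp) h0]
  rw [pow_succ, A_block]
  unfold AS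
  rw [Finset.mul_sum]
  refine Finset.sum_congr rfl fun y _ => ?_
  have : ∀ j ∈ Finset.range p, (if p ∣ 0 + p * (y + p ^ r * j) then Int.fract (t - ((0 + p * (y + p ^ r * j) : ℕ) : ℚ) ^ 2 / (p : ℚ) ^ (r + 2)) else 0) = Int.fract (t - (y : ℚ) ^ 2 / (p : ℚ) ^ r) := by
    intro j _
    rw [if_pos (by simp), Int.fract_eq_fract]
    refine ⟨- (2 * y * j + p ^ r * j ^ 2 : ℕ), ?_⟩
    push_cast
    field_simp
    ring
  rw [Finset.sum_congr rfl this]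
  simp

/-- character sum with shift -/
def AX (p : ℕ) [Fact p.Prime] (t : ℚ) : ℚ :=
  ∑ a ∈ Finset.range p, (legendreSym p a : ℚ) * Int.fract (t - (a : ℚ) / p)

lemma AS_one (p : ℕ) [Fact p.Prime] (hodd : Odd p) (t : ℚ) :
    AS p 1 t = Int.fract (p * t) + ((p : ℚ) - 1) / 2 + AX p t := by
  have hpr : p.Prime := Fact.out
  have hp : 0 < p := hpr.pos
  have hp' : (p : ℚ) ≠ 0 := by positivity
  have hp2 : p ≠ 2 := by rintro rfl; exact absurd hodd (by decide)
  have hu : ((-1 : ℤ) : ZMod p) ≠ 0 := by simp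
  have key := A_dist_unit p t (-1) hu
  rw [← key]
  unfold AX AS
  rw [← Finset.sum_add_distrib, pow_one]
  set f : ℤ → ℚ := fun l => Int.fract (t - (l : ℚ) / p) with hf
  have hper : ∀ k, f (k + p) = f k := by
    intro l
    simp only [hf]
    rw [← Int.fract_sub_one (t - (l : ℚ) / p)]
    congr 1; push_cast; field_simp; ring
  have e1 : ∑ y ∈ Finset.range p, Int.fract (t - (y : ℚ) ^ 2 / (p : ℚ) ^ 1) = ∑ y : ZMod p, f (y ^ 2).val := by
    have := A_zmod p (fun y : ℤ => f (y ^ 2))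
    have h2 : ∑ y ∈ Finset.range p, Int.fract (t - (y : ℚ) ^ 2 / (p : ℚ) ^ 1) = ∑ j ∈ Finset.range p, f ((j : ℤ) ^ 2) := by
      refine Finset.sum_congr rfl fun y _ => ?_
      simp [hf]
    rw [h2, this]
    refine Finset.sum_congr rfl fun y _ => ?_
    apply A_congr p f hper
    simp
  have e2 : ∑ x ∈ Finset.range p, (Int.fract (t + ((-1 : ℤ) * x : ℚ) / p) + (legendreSym p x : ℚ) * Int.fract (t - (x : ℚ) / p)) =
      ∑ a : ZMod p, (quadraticChar (ZMod p) a + 1 : ℚ) * f a.val := by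
    have := A_zmod p (fun x : ℤ => (legendreSym p x + 1 : ℚ) * f x)
    have h2 : ∑ x ∈ Finset.range p, (Int.fract (t + ((-1 : ℤ) * x : ℚ) / p) + (legendreSym p x : ℚ) * Int.fract (t - (x : ℚ) / p)) = ∑ x ∈ Finset.range p, (legendreSym p x + 1 : ℚ) * f x := by
      refine Finset.sum_congr rfl fun y _ => ?_
      simp only [hf]
      rw [show t + ((-1 : ℤ) * y : ℚ) / p = t - (y : ℚ) / p by push_cast; ring]
      push_cast; ring
    rw [h2, this]
    refine Finset.sum_congr rfl fun y _ => ?_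
    simp [legendreSym]
  rw [e1]
  push_cast at e2 ⊢
  rw [e2]
  rw [← Finset.sum_fiberwise (s := Finset.univ) (g := fun y : ZMod p => y ^ 2)]
  refine Finset.sum_congr rfl fun a _ => ?_
  rw [Finset.sum_congr rfl (g := fun _ => f a.val) (by intro i hi; simp at hi; rw [hi])]
  rw [Finset.sum_const, nsmul_eq_mul]
  congr 1
  have hc := quadraticChar_card_sqrts (F := ZMod p) (by rwa [ZMod.ringChar_zmod_n]) a
  have : (Finset.univ.filter fun y : ZMod p => y ^ 2 = a) = {x : ZMod p | x ^ 2 = a}.toFinset := by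
    ext; simp
  rw [this]
  exact_mod_cast hc

def AD (p : ℕ) [Fact p.Prime] (t : ℚ) : ℚ := Int.fract (p * t) - Int.fract t + AX p t

lemma AX_congr (p : ℕ) [Fact p.Prime] (s t : ℚ) (k : ℤ) (h : s = t + k) : AX p s = AX p t := by
  subst h
  unfold AX
  refine Finset.sum_congr rfl fun a _ => ?_
  rw [show t + k - (a : ℚ) / p = t - (a : ℚ) / p + k by ring, Int.fract_add_intCast]

lemma AD_congr (p : ℕ) [Fact p.Prime] (s t : ℚ) (k : ℤ) (h : s = t + k) : AD p s = AD p t := by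
  unfold AD
  rw [AX_congr p s t k h]
  subst h
  rw [Int.fract_add_intCast, show (p : ℚ) * (t + k) = p * t + ((p * k : ℤ) : ℚ) by push_cast; ring,
    Int.fract_add_intCast]

lemma AS_congr (p r : ℕ) (s t : ℚ) (k : ℤ) (h : s = t + k) : AS p r s = AS p r t := by
  subst h
  unfold AS
  refine Finset.sum_congr rfl fun a _ => ?_
  rw [show t + k - (a : ℚ) ^ 2 / (p : ℚ) ^ r = t - (a : ℚ) ^ 2 / (p : ℚ) ^ r + k by ring,
    Int.fract_add_intCast]

lemma AT_eq (p : ℕ) [Fact p.Prime] (hodd : Odd p) (r : ℕ) (t : ℚ) :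
    AT p (r + 1) t = ((p : ℚ) ^ (r + 1) - p ^ r) / 2 + AD p (p ^ r * t) := by
  induction r generalizing t with
  | zero =>
    have h1 := AS_eq_AT_one p t
    have h2 := AS_one p hodd t
    simp only [AD, zero_add, pow_zero, one_mul, pow_one]
    linarith
  | succ r ih =>
    rw [AT_step p hodd, ih, ← mul_assoc, ← pow_succ]
    ring

lemma A_psq (p : ℕ) (hodd : Odd p) : ∃ m : ℕ, p ^ 2 = 4 * m + 1 := by
  obtain ⟨k, rfl⟩ := hodd
  exact ⟨k ^ 2 + k, by ring⟩

lemma A_podd (p : ℕ) (hodd : Odd p) (r : ℕ) : ∃ m : ℕ, p ^ (2 * r) = 4 * m + 1 := by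
  rw [pow_mul']
  exact A_psq _ hodd.pow

def AC (p : ℕ) [Fact p.Prime] : ℚ := AX p 0 + AX p (-p / 4) + 3 / 4 - Int.fract (-(p : ℚ) / 4)

lemma A_AD (p : ℕ) [Fact p.Prime] (hodd : Odd p) : AD p 0 + AD p (-p / 4) = AC p := by
  unfold AD AC
  obtain ⟨m, hm⟩ := A_psq p hodd
  have : Int.fract ((p : ℚ) * (-p / 4)) = 3 / 4 := by
    have : (p : ℚ) * (-p / 4) = 3 / 4 + ((-(m : ℤ) - 1 : ℤ) : ℚ) := by
      have : (p : ℚ) ^ 2 = 4 * m + 1 := by exact_mod_cast hm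
      push_cast; linarith
    rw [this, Int.fract_add_intCast, Int.fract_eq_self]; norm_num
  rw [this]
  simp
  ring

lemma AW (p : ℕ) [Fact p.Prime] (hodd : Odd p) (r : ℕ) :
    AS p r 0 + AS p r (-(p : ℚ) ^ r / 4) = (p : ℚ) ^ r - Int.fract ((p : ℚ) ^ r / 4) * (p : ℚ) ^ (r / 2) +
          (((p : ℚ) ^ ((r + 1) / 2) - 1) / ((p : ℚ) - 1)) * AC p := by
  have hpr : p.Prime := Fact.out
  have h1 : (p : ℚ) - 1 ≠ 0 := by
    have : (1 : ℚ) < p := by exact_mod_cast hpr.one_lt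
    linarith
  induction r using Nat.twoStepInduction with
  | zero =>
    simp [AS]
    rw [show (-1 / 4 : ℚ) = 3 / 4 - 1 by norm_num, Int.fract_sub_one, Int.fract_eq_self.2 (by norm_num),
      Int.fract_eq_self.2 (by norm_num)]
    norm_num
  | one =>
    rw [AS_one p hodd, AS_one p hodd]
    have h2 := A_AD p hodd
    have h3 : Int.fract (-(p : ℚ) / 4) = 1 - Int.fract ((p : ℚ) / 4) := by
      rw [neg_div, Int.fract_neg]
      intro h
      rw [Int.fract_eq_zero_iff] at h
      obtain ⟨k, hk⟩ := h
      have : (p : ℚ) = 4 * k := by linarith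
      have : (p : ℤ) = 4 * k := by exact_mod_cast this
      obtain ⟨j, rfl⟩ := hodd
      omega
    unfold AD at h2
    simp only [pow_one] at *
    norm_num at h2 ⊢
    rw [div_self h1]
    linarith
  | more r ih _ =>
    rw [AS_step, AS_step, AT_eq p hodd, AT_eq p hodd]
    obtain ⟨m, hm⟩ := A_psq p hodd
    have hm' : (p : ℚ) ^ 2 = 4 * m + 1 := by exact_mod_cast hm
    obtain ⟨k, hk⟩ := A_podd p hodd (r + 1)
    have hk' : (p : ℚ) ^ (2 * (r + 1)) = 4 * k + 1 := by exact_mod_cast hk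
    rw [AS_congr p r (-(p : ℚ) ^ (r + 2) / 4) (-(p : ℚ) ^ r / 4) (-(p ^ r * m : ℕ)) (by
      push_cast; rw [pow_add, hm']; ring)]
    rw [AD_congr p ((p : ℚ) ^ (r + 1) * (-(p : ℚ) ^ (r + 2) / 4)) (-p / 4) (-(p * k : ℕ)) (by
      push_cast
      have : (p : ℚ) ^ (r + 1) * (-(p : ℚ) ^ (r + 2) / 4) = - p * (p : ℚ) ^ (2 * (r + 1)) / 4 := by ring
      rw [this, hk']; ring)]
    rw [mul_zero]
    have hf : Int.fract ((p : ℚ) ^ (r + 2) / 4) = Int.fract ((p : ℚ) ^ r / 4) := by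
      rw [Int.fract_eq_fract]
      refine ⟨(p ^ r * m : ℕ), ?_⟩
      push_cast; rw [pow_add, hm']; ring
    rw [hf, show (r + 2) / 2 = r / 2 + 1 by omega, show (r + 2 + 1) / 2 = (r + 1) / 2 + 1 by omega]
    have h2 := A_AD p hodd
    have e : (((p : ℚ) ^ ((r + 1) / 2 + 1) - 1) / ((p : ℚ) - 1)) * AC p =
       p * ((((p : ℚ) ^ ((r + 1) / 2) - 1) / ((p : ℚ) - 1)) * AC p) + AC p := by
      field_simp; ring
    rw [e, ← h2]
    linear_combination (p : ℚ) * ih - p * (((p : ℚ) ^ ((r + 1) / 2) - 1) / ((p : ℚ) - 1)) * h2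

lemma A_evenodd (n : ℕ) (g : ℕ → ℚ) : ∑ x ∈ Finset.range (2 * n), g x =
    ∑ y ∈ Finset.range n, g (2 * y) + ∑ y ∈ Finset.range n, g (2 * y + 1) := by
  induction n with
  | zero => simp
  | succ n ih =>
    rw [show 2 * (n + 1) = 2 * n + 1 + 1 by ring, Finset.sum_range_succ, Finset.sum_range_succ, ih,
      Finset.sum_range_succ, Finset.sum_range_succ]
    ring

lemma A_total (p : ℕ) [Fact p.Prime] (hodd : Odd p) (r : ℕ) :
    ∑ x ∈ Finset.Icc 1 (2 * p ^ r), Int.fract (-(x : ℚ) ^ 2 / (4 * (p : ℚ) ^ r)) =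
      AS p r 0 + AS p r (-(p : ℚ) ^ r / 4) := by
  have hp : 0 < p := (Fact.out : p.Prime).pos
  have hp' : (p : ℚ) ≠ 0 := by positivity
  have h1 : ∑ x ∈ Finset.Icc 1 (2 * p ^ r), Int.fract (-(x : ℚ) ^ 2 / (4 * (p : ℚ) ^ r)) =
     ∑ x ∈ Finset.range (2 * p ^ r), Int.fract (-(x : ℚ) ^ 2 / (4 * (p : ℚ) ^ r)) := by
    have e1 := Finset.sum_range_succ (fun x : ℕ => Int.fract (-(x : ℚ) ^ 2 / (4 * (p : ℚ) ^ r))) (2 * p ^ r)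
    have e2 := Finset.sum_range_succ' (fun x : ℕ => Int.fract (-(x : ℚ) ^ 2 / (4 * (p : ℚ) ^ r))) (2 * p ^ r)
    have e3 : Int.fract (-((2 * p ^ r : ℕ) : ℚ) ^ 2 / (4 * (p : ℚ) ^ r)) = 0 := by
      rw [Int.fract_eq_zero_iff]
      refine ⟨-(p ^ r : ℕ), ?_⟩
      push_cast; field_simp; ring
    rw [e3, e2] at e1
    have e4 : ∑ x ∈ Finset.Icc 1 (2 * p ^ r), Int.fract (-(x : ℚ) ^ 2 / (4 * (p : ℚ) ^ r)) =
      ∑ x ∈ Finset.range (2 * p ^ r), Int.fract (-((x + 1 : ℕ) : ℚ) ^ 2 / (4 * (p : ℚ) ^ r)) := by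
      rw [Finset.sum_bij' (fun x _ => x - 1) (fun x _ => x + 1)] <;> simp <;> intros
      · omega
      · omega
      · rw [show ∀ x : ℕ, 1 ≤ x → ((x - 1 : ℕ) : ℚ) + 1 = x from fun x hx => by
          rw [Nat.cast_sub hx]; simp]
        assumption
    rw [e4]
    simpa using e1
  rw [h1, A_evenodd]
  congr 1
  · unfold AS
    refine Finset.sum_congr rfl fun y _ => ?_
    congr 1; push_cast; field_simp; ring
  · obtain ⟨M, hM⟩ : Odd (p ^ r) := hodd.pow
    set f : ℤ → ℚ := fun l => Int.fract (-(2 * l + 1 : ℚ) ^ 2 / (4 * (p : ℚ) ^ r)) with hf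
    have := A_shift (p ^ r) f (by
      intro l
      simp only [hf]
      rw [Int.fract_eq_fract]
      refine ⟨-(2 * l + 1 + (p ^ r : ℕ)), ?_⟩
      push_cast; field_simp; ring) M
    unfold AS
    have e : ∑ y ∈ Finset.range (p ^ r), Int.fract (-((2 * y + 1 : ℕ) : ℚ) ^ 2 / (4 * (p : ℚ) ^ r)) =
      ∑ j ∈ Finset.range (p ^ r), f j := by
      refine Finset.sum_congr rfl fun y _ => ?_
      simp [hf]
    rw [e, ← this]
    refine Finset.sum_congr rfl fun y _ => ?_
    simp only [hf]
    rw [Int.fract_eq_fract]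
    refine ⟨-y, ?_⟩
    have hM' : (p : ℚ) ^ r = 2 * M + 1 := by exact_mod_cast hM
    have : (2 * (((M : ℤ) + (y : ℤ) : ℤ) : ℚ) + 1) = p ^ r + 2 * y := by rw [hM']; push_cast; ring
    rw [this]
    push_cast; field_simp; ring

lemma A_leg_per (p : ℕ) [Fact p.Prime] (k : ℤ) : legendreSym p (k + p) = legendreSym p k := by
  simp [legendreSym]

lemma A_leg_sum (p : ℕ) [Fact p.Prime] (hodd : Odd p) :
    ∑ a ∈ Finset.range p, (legendreSym p a : ℚ) = 0 := by
  have hp2 : p ≠ 2 := by rintro rfl; exact absurd hodd (by decide)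
  rw [A_zmod p (fun l => (legendreSym p l : ℚ))]
  have := quadraticChar_sum_zero (F := ZMod p) (by rwa [ZMod.ringChar_zmod_n])
  have h2 : ∑ a : ZMod p, (legendreSym p a.val : ℚ) = ((∑ a : ZMod p, quadraticChar (ZMod p) a : ℤ) : ℚ) := by
    push_cast
    refine Finset.sum_congr rfl fun a _ => ?_
    simp [legendreSym]
  exact h2.trans (by exact_mod_cast this)

/-- unit substitution in character sums -/
lemma A_subst (p : ℕ) [Fact p.Prime] (f : ℤ → ℚ) (hf : ∀ k, f (k + p) = f k) (u : ℤ)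
    (hu : (u : ZMod p) ≠ 0) :
    ∑ a ∈ Finset.range p, (legendreSym p a : ℚ) * f (u * a) =
      (legendreSym p u : ℚ) * ∑ a ∈ Finset.range p, (legendreSym p a : ℚ) * f a := by
  have h := A_mulunit p (fun l => (legendreSym p l : ℚ) * f l) (by
    intro k; simp only [A_leg_per, hf]) u hu
  simp only [legendreSym.mul] at h
  rw [← h, Finset.mul_sum]
  refine Finset.sum_congr rfl fun a _ => ?_
  have h1 : (legendreSym p u : ℚ) ^ 2 = 1 := by exact_mod_cast legendreSym.sq_one p hu
  push_cast
  linear_combination (-(legendreSym p a : ℚ) * f (u * a)) * h1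

lemma A_fper (p : ℕ) [Fact p.Prime] (t : ℚ) (k : ℤ) :
    Int.fract (t - ((k + p : ℤ) : ℚ) / p) = Int.fract (t - (k : ℚ) / p) := by
  have hp : 0 < p := (Fact.out : p.Prime).pos
  have hp' : (p : ℚ) ≠ 0 := by positivity
  rw [← Int.fract_sub_one (t - (k : ℚ) / p)]
  congr 1; push_cast; field_simp; ring

lemma A_two_ne (p : ℕ) [Fact p.Prime] (hodd : Odd p) : (2 : ZMod p) ≠ 0 := by
  have hpr : p.Prime := Fact.out
  have : ((2 : ℕ) : ZMod p) ≠ 0 := by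
    rw [Ne, ZMod.natCast_eq_zero_iff]
    intro h
    have := Nat.le_of_dvd (by norm_num) h
    have := hpr.two_le
    obtain ⟨k, rfl⟩ := hodd
    omega
  exact_mod_cast this

/-- reflection -/
lemma AX_neg (p : ℕ) [Fact p.Prime] (hodd : Odd p) (t : ℚ)
    (ht : ∀ a ∈ Finset.range p, a ≠ 0 → Int.fract (t - (a : ℚ) / p) ≠ 0) :
    AX p (-t) = -(legendreSym p (-1) : ℚ) * AX p t := by
  have h := A_subst p (fun l => Int.fract (-t - (l : ℚ) / p)) (A_fper p (-t)) (-1) (by simp)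
  have h1 : (legendreSym p (-1) : ℚ) ^ 2 = 1 := by exact_mod_cast legendreSym.sq_one p (a := -1) (by simp)
  have h2 : ∑ a ∈ Finset.range p, (legendreSym p a : ℚ) * Int.fract (-t - ((-1 * a : ℤ) : ℚ) / p) =
     - AX p t := by
    unfold AX
    have e : ∀ a ∈ Finset.range p, (legendreSym p a : ℚ) * Int.fract (-t - ((-1 * a : ℤ) : ℚ) / p) =
       (legendreSym p a : ℚ) - (legendreSym p a : ℚ) * Int.fract (t - (a : ℚ) / p) := by
      intro a ha
      by_cases h0 : a = 0
      · subst h0; simp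
      · rw [show -t - ((-1 * a : ℤ) : ℚ) / p = -(t - (a : ℚ) / p) by push_cast; ring,
          Int.fract_neg (ht a ha h0)]
        ring
    rw [Finset.sum_congr rfl e, Finset.sum_sub_distrib, A_leg_sum p hodd]
    ring
  rw [h2] at h
  have h3 : AX p (-t) = ∑ a ∈ Finset.range p, (legendreSym p a : ℚ) * Int.fract (-t - ((a : ℤ) : ℚ) / p) := by
    simp [AX]
  rw [← h3] at h
  linear_combination (-(legendreSym p (-1) : ℚ)) * h - (AX p (-t)) * h1

lemma A_fr (p : ℕ) [Fact p.Prime] (a : ℕ) (ha : a ∈ Finset.range p) (h0 : a ≠ 0) :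
    Int.fract (0 - (a : ℚ) / p) = 1 - (a : ℚ) / p := by
  have hp : 0 < p := (Fact.out : p.Prime).pos
  have hp' : (0 : ℚ) < p := by positivity
  rw [← Int.fract_add_one, Int.fract_eq_self.2]
  · ring
  · have h1 : (0 : ℚ) < a := by exact_mod_cast Nat.pos_of_ne_zero h0
    have h2 : (a : ℚ) < p := by exact_mod_cast (Finset.mem_range.1 ha)
    have h3 : (a : ℚ) / p < 1 := (div_lt_one hp').2 h2
    have h4 : 0 < (a : ℚ) / p := by positivity
    constructor <;> linarith

lemma AX_zero (p : ℕ) [Fact p.Prime] (hodd : Odd p) : AX p 0 = hpStar p := by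
  unfold AX hpStar
  have e : ∀ a ∈ Finset.range p, (legendreSym p a : ℚ) * Int.fract (0 - (a : ℚ) / p) =
       (legendreSym p a : ℚ) - (legendreSym p a : ℚ) * ((a : ℚ) / p) := by
    intro a ha
    by_cases h0 : a = 0
    · subst h0; simp
    · rw [A_fr p a ha h0]; ring
  rw [Finset.sum_congr rfl e, Finset.sum_sub_distrib, A_leg_sum p hodd]
  ring

lemma AX_zero_one (p : ℕ) [Fact p.Prime] (hodd : Odd p) (h : p % 4 = 1) : AX p 0 = 0 := by
  have h1 := AX_neg p hodd 0 (by
    intro a ha h0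
    have hp : 0 < p := (Fact.out : p.Prime).pos
    have hp' : (0 : ℚ) < p := by positivity
    rw [A_fr p a ha h0]
    have h2 : (a : ℚ) < p := by exact_mod_cast (Finset.mem_range.1 ha)
    have h3 : (a : ℚ) / p < 1 := (div_lt_one hp').2 h2
    linarith)
  rw [neg_zero, legendreSym.at_neg_one (by omega), ZMod.χ₄_nat_one_mod_four h] at h1
  push_cast at h1
  linarith

lemma AX_quarter (p : ℕ) [Fact p.Prime] (hodd : Odd p) (h : p % 4 = 3) :
    AX p (1 / 4) = (1 - (legendreSym p 2 : ℚ)) / 2 * AX p 0 := by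
  have hp : 0 < p := (Fact.out : p.Prime).pos
  have hp' : (p : ℚ) ≠ 0 := by positivity
  have h2 : ((2 : ℤ) : ZMod p) ≠ 0 := by exact_mod_cast A_two_ne p hodd
  have hs := AX_neg p hodd (1 / 4) (by
    intro a ha h0 hh
    rw [Int.fract_eq_zero_iff] at hh
    obtain ⟨k, hk⟩ := hh
    have : (p : ℚ) = 4 * (a + k * p) := by field_simp at hk; linarith
    have : (p : ℤ) = 4 * (a + k * p) := by exact_mod_cast this
    omega)
  rw [legendreSym.at_neg_one (by omega), ZMod.χ₄_nat_three_mod_four h] at hs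
  push_cast at hs
  have d2 : AX p 0 + AX p (1 / 2) = (legendreSym p 2 : ℚ) * AX p 0 := by
    have := A_subst p (fun l => Int.fract (0 - (l : ℚ) / p)) (A_fper p 0) 2 h2
    have e3 : AX p 0 = ∑ a ∈ Finset.range p, (legendreSym p a : ℚ) * Int.fract (0 - ((a : ℤ) : ℚ) / p) := by
      simp [AX]
    rw [← e3] at this
    rw [← this]
    have l0 := A_leg_sum p hodd
    unfold AX
    rw [← Finset.sum_add_distrib]
    have : ∀ a ∈ Finset.range p, (legendreSym p a : ℚ) * Int.fract (0 - (a : ℚ) / p) + (legendreSym p a : ℚ) * Int.fract (1 / 2 - (a : ℚ) / p)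
      = (legendreSym p a : ℚ) * Int.fract (0 - ((2 * a : ℤ) : ℚ) / p) + (legendreSym p a : ℚ) * (1 / 2) := by
      intro a _
      have := A_dist 2 (by norm_num) (-(a : ℚ) / p)
      simp [Finset.sum_range_succ] at this
      rw [show (1 / 2 - (a : ℚ) / p) = -(a : ℚ) / p + 2⁻¹ by ring, show 0 - (a : ℚ) / p = -(a : ℚ) / p by ring,
        ← mul_add, this, show (0 - ((2 * a : ℤ) : ℚ) / p) = 2 * (-(a : ℚ) / p) by push_cast; ring]
      ring
    rw [Finset.sum_congr rfl this, Finset.sum_add_distrib, ← Finset.sum_mul, l0]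
    ring
  have d4 : AX p 0 + AX p (1 / 4) + AX p (1 / 2) + AX p (3 / 4) = AX p 0 := by
    have h4 : ((4 : ℤ) : ZMod p) ≠ 0 := by
      have : ((4 : ℤ) : ZMod p) = ((2 : ℤ) : ZMod p) * ((2 : ℤ) : ZMod p) := by push_cast; norm_num
      rw [this]; exact mul_ne_zero h2 h2
    have := A_subst p (fun l => Int.fract (0 - (l : ℚ) / p)) (A_fper p 0) 4 h4
    have e3 : AX p 0 = ∑ a ∈ Finset.range p, (legendreSym p a : ℚ) * Int.fract (0 - ((a : ℤ) : ℚ) / p) := by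
      simp [AX]
    rw [← e3, show legendreSym p 4 = 1 from legendreSym.sq_one' p (a := 2) h2, Int.cast_one, one_mul] at this
    have goal2 : AX p 0 + AX p (1 / 4) + AX p (1 / 2) + AX p (3 / 4) = ∑ a ∈ Finset.range p, (legendreSym p a : ℚ) * Int.fract (0 - ((4 * a : ℤ) : ℚ) / p) := by
      have l0 := A_leg_sum p hodd
      unfold AX
      rw [← Finset.sum_add_distrib, ← Finset.sum_add_distrib, ← Finset.sum_add_distrib]
      have : ∀ a ∈ Finset.range p, (legendreSym p a : ℚ) * Int.fract (0 - (a : ℚ) / p) + (legendreSym p a : ℚ) * Int.fract (1 / 4 - (a : ℚ) / p) + (legendreSym p a : ℚ) * Int.fract (1 / 2 - (a : ℚ) / p) + (legendreSym p a : ℚ) * Int.fract (3 / 4 - (a : ℚ) / p)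
        = (legendreSym p a : ℚ) * Int.fract (0 - ((4 * a : ℤ) : ℚ) / p) + (legendreSym p a : ℚ) * (3 / 2) := by
        intro a _
        have := A_dist 4 (by norm_num) (-(a : ℚ) / p)
        simp [Finset.sum_range_succ] at this
        rw [show (1 / 2 - (a : ℚ) / p) = -(a : ℚ) / p + 2 / 4 by ring, show 0 - (a : ℚ) / p = -(a : ℚ) / p by ring,
          show (1 / 4 - (a : ℚ) / p) = -(a : ℚ) / p + 4⁻¹ by ring, show (3 / 4 - (a : ℚ) / p) = -(a : ℚ) / p + 3 / 4 by ring,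
          ← mul_add, ← mul_add, ← mul_add, this, show (0 - ((4 * a : ℤ) : ℚ) / p) = 4 * (-(a : ℚ) / p) by push_cast; ring]
        ring
      rw [Finset.sum_congr rfl this, Finset.sum_add_distrib, ← Finset.sum_mul, l0]
      ring
    rw [goal2, this]
  have e : AX p (3 / 4) = AX p (-(1 / 4)) := AX_congr p _ _ 1 (by norm_num)
  rw [e, hs] at d4
  linarith

lemma A_final_one (p : ℕ) [Fact p.Prime] (hodd : Odd p) (h : p % 4 = 1) :
    AC p = AX p (-1 / 4) := by
  unfold AC
  rw [AX_zero_one p hodd h]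
  obtain ⟨k, hk⟩ : ∃ k : ℕ, p = 4 * k + 1 := ⟨p / 4, by omega⟩
  have hk' : (p : ℚ) = 4 * k + 1 := by exact_mod_cast hk
  rw [AX_congr p (-p / 4) (-1 / 4) (-k) (by rw [hk']; push_cast; ring)]
  rw [show -(p : ℚ) / 4 = 3 / 4 + ((-k - 1 : ℤ) : ℚ) by rw [hk']; push_cast; ring, Int.fract_add_intCast,
    Int.fract_eq_self.2 (by norm_num)]
  ring

lemma A_final_three (p : ℕ) [Fact p.Prime] (hodd : Odd p) (h : p % 4 = 3) :
    AC p = (3 - (legendreSym p 2 : ℚ)) / 2 * hpStar p + 1 / 2 := by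
  unfold AC
  rw [← AX_zero p hodd]
  obtain ⟨k, hk⟩ : ∃ k : ℕ, p = 4 * k + 3 := ⟨p / 4, by omega⟩
  have hk' : (p : ℚ) = 4 * k + 3 := by exact_mod_cast hk
  rw [AX_congr p (-p / 4) (1 / 4) (-k - 1) (by rw [hk']; push_cast; ring), AX_quarter p hodd h]
  rw [show -(p : ℚ) / 4 = 1 / 4 + ((-k - 1 : ℤ) : ℚ) by rw [hk']; push_cast; ring, Int.fract_add_intCast,
    Int.fract_eq_self.2 (by norm_num)]
  ring

open Polynomial in
lemma C_G (p : ℕ) [Fact p.Prime] (k : ℕ) (hk : k ≤ p - 1) : ∃ R : (ZMod p)[X],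
    ∑ a ∈ Finset.range p, C ((a : ZMod p) ^ k) * X ^ a = (X - 1) ^ (p - 1 - k) * R ∧
      R.eval 1 = (-1) ^ k * (k.factorial : ZMod p) := by
  have hp : 1 < p := (Fact.out : p.Prime).one_lt
  induction k with
  | zero =>
    refine ⟨1, ?_, by simp⟩
    have h1 : ¬ p ∣ 1 := by rw [Nat.dvd_one]; omega
    have h := cyclotomic_mul_prime_eq_pow_of_not_dvd (ZMod p) h1
    rw [one_mul, cyclotomic_one, cyclotomic_prime] at h
    simp [h]
  | succ k ih =>
    obtain ⟨R, hR, hR1⟩ := ih (by omega)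
    obtain ⟨n, hn⟩ : ∃ n, p - 1 - k = n + 1 := ⟨p - 1 - k - 1, by omega⟩
    have hn' : p - 1 - (k + 1) = n := by omega
    rw [hn] at hR
    rw [hn']
    refine ⟨X * (((n + 1 : ℕ) : (ZMod p)[X]) * R + (X - 1) * derivative R), ?_, ?_⟩
    · have h := congrArg (fun q => X * derivative q) hR
      simp only [derivative_sum, derivative_mul, derivative_C, zero_mul, zero_add,
        Finset.mul_sum, derivative_pow, derivative_sub, derivative_X, derivative_one, sub_zero,
        mul_one, Nat.add_sub_cancel] at h
      rw [show X * (C (((n + 1 : ℕ) : ZMod p)) * (X - 1) ^ n * R + (X - 1) ^ (n + 1) * derivative R) =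
        (X - 1) ^ n * (X * (((n + 1 : ℕ) : (ZMod p)[X]) * R + (X - 1) * derivative R)) by
          rw [C_eq_natCast]; ring] at h
      rw [← h]
      refine Finset.sum_congr rfl fun a _ => ?_
      rcases a with _ | a
      · simp
      · rw [Nat.add_sub_cancel, pow_succ, C_mul]; push_cast; ring
    · simp only [eval_mul, eval_X, eval_add, eval_sub, eval_one, sub_self, zero_mul, add_zero,
        eval_natCast, one_mul, hR1]
      have : ((n + 1 : ℕ) : ZMod p) = -((k + 1 : ℕ) : ZMod p) := by
        rw [eq_neg_iff_add_eq_zero, ← Nat.cast_add, show n + 1 + (k + 1) = p by omega]; simp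
      rw [this, Nat.factorial_succ, pow_succ]
      push_cast; ring

open Polynomial in
lemma C_Q (p : ℕ) [Fact p.Prime] (m : ℕ) (hm : 2 * m < p) : ∃ R : (ZMod p)[X],
    ∏ k ∈ Finset.range m, ((X : (ZMod p)[X]) ^ (k + 1) - X ^ (p - (k + 1))) = (X - 1) ^ m * R ∧
      R.eval 1 = 2 ^ m * (m.factorial : ZMod p) := by
  induction m with
  | zero => exact ⟨1, by simp, by simp⟩
  | succ k ih =>
    obtain ⟨R, hR, hR1⟩ := ih (by omega)
    obtain ⟨n, hn⟩ : ∃ n, p - (k + 1) = k + 1 + n := ⟨p - (k + 1) - (k + 1), by omega⟩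
    refine ⟨R * (- X ^ (k + 1) * ∑ i ∈ Finset.range n, X ^ i), ?_, ?_⟩
    · rw [Finset.prod_range_succ, hR, hn, pow_add X (k + 1) n]
      have := mul_geom_sum (X : (ZMod p)[X]) n
      linear_combination ((X - 1) ^ k * R * X ^ (k + 1)) * this
    · simp only [eval_mul, eval_neg, eval_pow, eval_X, one_pow, eval_geom_sum, hR1]
      have : (n : ZMod p) = -(2 * (k + 1 : ℕ) : ZMod p) := by
        rw [eq_neg_iff_add_eq_zero]
        have : ((n + 2 * (k + 1) : ℕ) : ZMod p) = 0 := by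
          rw [show n + 2 * (k + 1) = p by omega]; simp
        exact_mod_cast this
      simp [this, Nat.factorial_succ]
      ring

open Polynomial in
lemma C_sign (p : ℕ) [Fact p.Prime] (hodd : Odd p) (ω : ℂ) (hω : IsPrimitiveRoot ω p) (ε : ℤ)
    (h : ∑ a ∈ Finset.range p, (legendreSym p a : ℂ) * ω ^ a =
      ε * ∏ k ∈ Finset.range (p / 2), (ω ^ (k + 1) - ω ^ (p - (k + 1)))) :
    (ε : ZMod p) * legendreSym p 2 = (-1) ^ (p / 2) := by
  have hp := (Fact.out : p.Prime)
  have hp1 : 1 < p := hp.one_lt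
  have hp2 : p / 2 * 2 + 1 = p := by obtain ⟨k, hk⟩ := hodd; omega
  set F : ℤ[X] := ∑ a ∈ Finset.range p, C (legendreSym p a) * X ^ a -
    C ε * ∏ k ∈ Finset.range (p / 2), (X ^ (k + 1) - X ^ (p - (k + 1))) with hF
  have h0 : aeval ω F = 0 := by
    simp only [hF, map_sub, map_sum, map_mul, map_prod, map_pow, aeval_X, aeval_C]
    simpa [sub_eq_zero] using h
  have h1 := minpoly.isIntegrallyClosed_dvd (hω.isIntegral hp.pos) h0
  rw [← cyclotomic_eq_minpoly hω hp.pos] at h1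
  have h2 := Polynomial.map_dvd (Int.castRingHom (ZMod p)) h1
  have h1' : ¬ p ∣ 1 := by rw [Nat.dvd_one]; omega
  have h3 := cyclotomic_mul_prime_eq_pow_of_not_dvd (ZMod p) h1'
  rw [one_mul, cyclotomic_one] at h3
  rw [map_cyclotomic, h3] at h2
  obtain ⟨R, hR, hR1⟩ := C_G p (p / 2) (by omega)
  obtain ⟨S, hS, hS1⟩ := C_Q p (p / 2) (by omega)
  have h4 : F.map (Int.castRingHom (ZMod p)) = (X - 1) ^ (p / 2) * (R - C (ε : ZMod p) * S) := by
    rw [mul_sub, mul_left_comm, ← hS]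
    rw [show p / 2 = p - 1 - p / 2 by omega, ← hR, show p - 1 - p / 2 = p / 2 by omega]
    simp only [hF, Polynomial.map_sub, Polynomial.map_sum, Polynomial.map_mul, Polynomial.map_prod,
      Polynomial.map_pow, map_X, map_C]
    congr 1
    · refine Finset.sum_congr rfl fun a _ => ?_
      have := legendreSym.eq_pow p a
      simp only [eq_intCast, this]
      simp
  have h5 : (X - 1 : (ZMod p)[X]) ^ (p / 2) * (X - 1) ∣ (X - 1) ^ (p / 2) * (R - C (ε : ZMod p) * S) := by
    rw [← h4, ← pow_succ]
    exact (pow_dvd_pow _ (by omega)).trans h2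
  have hX : (X - 1 : (ZMod p)[X]) ≠ 0 := by
    have := X_sub_C_ne_zero (1 : ZMod p)
    simpa using this
  have h6 := (mul_dvd_mul_iff_left (pow_ne_zero _ hX)).1 h5
  obtain ⟨U, hU⟩ := h6
  have h7 := congrArg (eval 1) hU
  simp only [eval_sub, eval_mul, eval_C, hR1, hS1, eval_X, eval_one, sub_self, zero_mul] at h7
  have hf : ((p / 2).factorial : ZMod p) ≠ 0 := by
    rw [Ne, ZMod.natCast_eq_zero_iff, hp.dvd_factorial]; omega
  have h8 := legendreSym.eq_pow p 2
  rw [h8]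
  apply mul_right_cancel₀ hf
  push_cast
  linear_combination -h7

lemma C_sum_zmod {M : Type*} [AddCommMonoid M] (n : ℕ) [NeZero n] (f : ZMod n → M) :
    ∑ j ∈ Finset.range n, f (j : ℕ) = ∑ a : ZMod n, f a := by
  refine Finset.sum_bij' (fun j _ => (j : ZMod n)) (fun a _ => a.val) ?_ ?_ ?_ ?_ ?_
  · simp
  · intro a _; simpa using ZMod.val_lt a
  · intro j hj; simpa using ZMod.val_cast_of_lt (Finset.mem_range.1 hj)
  · intro a _; simp
  · intro a _; simp

lemma C_std (p : ℕ) [NeZero p] (a : ℕ) :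
    ZMod.stdAddChar (N := p) (a : ZMod p) = Complex.exp (2 * Real.pi * Complex.I / p) ^ a := by
  have := ZMod.stdAddChar_coe (N := p) (a : ℤ)
  push_cast at this
  rw [this, ← Complex.exp_nat_mul]
  congr 1; ring

noncomputable def CG (p : ℕ) [Fact p.Prime] : ℂ :=
  ∑ a : ZMod p, (quadraticChar (ZMod p) a : ℂ) * ZMod.stdAddChar a

lemma CG_eq (p : ℕ) [Fact p.Prime] : CG p = ∑ a ∈ Finset.range p, (legendreSym p a : ℂ) *
    Complex.exp (2 * Real.pi * Complex.I / p) ^ a := by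
  unfold CG
  rw [← C_sum_zmod p]
  refine Finset.sum_congr rfl fun a _ => ?_
  rw [C_std, legendreSym]; simp

lemma CG_sq (p : ℕ) [Fact p.Prime] (hodd : Odd p) : CG p ^ 2 = (-1) ^ (p / 2) * p := by
  have hp2 : p ≠ 2 := by rintro rfl; exact absurd hodd (by decide)
  have hq : ringChar (ZMod p) ≠ 2 := by rwa [ZMod.ringChar_zmod_n]
  have h1 : (quadraticChar (ZMod p)).ringHomComp (Int.castRingHom ℂ) ≠ 1 := by
    rw [MulChar.ringHomComp_ne_one_iff]
    · exact quadraticChar_ne_one hq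
    · exact Int.cast_injective
  have h2 := gaussSum_sq h1 ((quadraticChar_isQuadratic (ZMod p)).comp _)
    (ZMod.isPrimitive_stdAddChar p)
  have h3 : gaussSum ((quadraticChar (ZMod p)).ringHomComp (Int.castRingHom ℂ)) ZMod.stdAddChar = CG p := rfl
  rw [h3] at h2
  rw [h2, ZMod.card]
  congr 1
  have : quadraticChar (ZMod p) (-1) = (-1) ^ (p / 2) := by
    rw [quadraticChar_neg_one hq, ZMod.card, ZMod.χ₄_eq_neg_one_pow]
    obtain ⟨k, hk⟩ := hodd; omega
  rw [MulChar.ringHomComp_apply, this]; simp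

lemma C_Qsq (p : ℕ) [Fact p.Prime] (hodd : Odd p) (ω : ℂ) (hω : IsPrimitiveRoot ω p) :
    (-1) ^ (p / 2) * (∏ k ∈ Finset.range (p / 2), (ω ^ (k + 1) - ω ^ (p - (k + 1)))) ^ 2 = p := by
  obtain ⟨m, hm⟩ := hodd
  have hp2 : p / 2 = m := by omega
  rw [hp2]
  have hμ : IsPrimitiveRoot (ω ^ 2) p := hω.pow_of_coprime 2 (by
    rw [Nat.coprime_comm, hm]; simp)
  obtain ⟨q, hq⟩ : ∃ q, p = q + 1 := ⟨p - 1, by omega⟩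
  have hq2 : q = m + m := by omega
  have h1 := IsPrimitiveRoot.prod_one_sub_pow_eq_order (hq ▸ hμ)
  have h2 : (q : ℂ) + 1 = p := by rw [hq]; push_cast; ring
  rw [h2, hq2, Finset.prod_range_add] at h1
  rw [← h1, ← Finset.prod_range_reflect (fun x => 1 - (ω ^ 2) ^ (m + x + 1)) m,
    ← Finset.prod_mul_distrib, ← Finset.prod_pow, ← Finset.card_range m, ← Finset.prod_const,
    Finset.card_range, ← Finset.prod_mul_distrib]
  refine Finset.prod_congr rfl fun k hk => ?_
  have hk' := Finset.mem_range.1 hk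
  have e1 : m + (m - 1 - k) + 1 = p - (k + 1) := by omega
  rw [e1]
  have e2 : ω ^ (k + 1) * ω ^ (p - (k + 1)) = 1 := by
    rw [← pow_add, show k + 1 + (p - (k + 1)) = p by omega, hω.pow_eq_one]
  rw [pow_right_comm, pow_right_comm ω 2]
  linear_combination (1 - ω ^ (k + 1) * ω ^ (p - (k + 1))) * e2

lemma C_Qpos (p : ℕ) [Fact p.Prime] (hodd : Odd p) : ∃ s : ℝ, 0 < s ∧
    ∏ k ∈ Finset.range (p / 2), (Complex.exp (2 * Real.pi * Complex.I / p) ^ (k + 1) -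
      Complex.exp (2 * Real.pi * Complex.I / p) ^ (p - (k + 1))) = Complex.I ^ (p / 2) * s := by
  have hp := (Fact.out : p.Prime)
  have hpp : (0:ℝ) < p := by exact_mod_cast hp.pos
  refine ⟨∏ k ∈ Finset.range (p / 2), 2 * Real.sin (2 * Real.pi * (k + 1) / p), ?_, ?_⟩
  · apply Finset.prod_pos
    intro k hk
    have hk' := Finset.mem_range.1 hk
    have hk2 : ((2 * (k + 1) : ℕ) : ℝ) < p := by
      have : 2 * (k + 1) < p := by obtain ⟨m, hm⟩ := hodd; omega
      exact_mod_cast this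
    push_cast at hk2
    apply mul_pos two_pos
    apply Real.sin_pos_of_pos_of_lt_pi
    · positivity
    · rw [div_lt_iff₀ hpp]
      nlinarith [Real.pi_pos]
  · push_cast
    rw [← Finset.card_range (p / 2), ← Finset.prod_const, Finset.card_range, ← Finset.prod_mul_distrib]
    refine Finset.prod_congr rfl fun k hk => ?_
    have hk' := Finset.mem_range.1 hk
    have hpc : (p : ℂ) ≠ 0 := by exact_mod_cast hp.ne_zero
    rw [Complex.sin, ← Complex.exp_nat_mul, ← Complex.exp_nat_mul, Nat.cast_sub (by omega), sub_mul]
    rw [show (p : ℂ) * (2 * Real.pi * Complex.I / p) = 2 * Real.pi * Complex.I by field_simp,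
      Complex.exp_sub, Complex.exp_two_pi_mul_I]
    rw [show -(2 * (Real.pi : ℂ) * (k + 1) / p) * Complex.I = -(((k + 1 : ℕ) : ℂ) * (2 * Real.pi * Complex.I / p)) by
      push_cast; ring]
    rw [show (2 * (Real.pi : ℂ) * (k + 1) / p) * Complex.I = (((k + 1 : ℕ) : ℂ) * (2 * Real.pi * Complex.I / p)) by
      push_cast; ring]
    rw [Complex.exp_neg]
    linear_combination (Complex.exp (((k + 1 : ℕ) : ℂ) * (2 * Real.pi * Complex.I / p)) - (Complex.exp (((k + 1 : ℕ) : ℂ) * (2 * Real.pi * Complex.I / p)))⁻¹) * Complex.I_mul_I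

lemma CG_val (p : ℕ) [Fact p.Prime] (hodd : Odd p) :
    CG p = (-1) ^ (p / 2) * legendreSym p 2 * Complex.I ^ (p / 2) * (Real.sqrt p : ℝ) := by
  have hp := (Fact.out : p.Prime)
  have hp2 : 2 < p := by
    have := hp.two_le
    obtain ⟨k, hk⟩ := hodd; omega
  have hω := Complex.isPrimitiveRoot_exp p hp.ne_zero
  obtain ⟨s, hs, hQ⟩ := C_Qpos p hodd
  have h1 := C_Qsq p hodd _ hω
  have h2 := CG_sq p hodd
  set Q := ∏ k ∈ Finset.range (p / 2), (Complex.exp (2 * Real.pi * Complex.I / p) ^ (k + 1) -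
      Complex.exp (2 * Real.pi * Complex.I / p) ^ (p - (k + 1))) with hQd
  have hm1 : ((-1 : ℂ) ^ (p / 2)) * (-1) ^ (p / 2) = 1 := by rw [← mul_pow]; simp
  have hs2 : s ^ 2 = p := by
    rw [hQ, mul_pow, ← pow_mul, mul_comm (p / 2) 2, pow_mul, Complex.I_sq, ← mul_assoc, hm1,
      one_mul] at h1
    exact_mod_cast h1
  have hs3 : s = Real.sqrt p := by rw [← hs2, Real.sqrt_sq hs.le]
  have h3 : CG p ^ 2 = Q ^ 2 := by
    rw [h2, ← h1, ← mul_assoc, hm1, one_mul]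
  obtain ⟨ε, hε, hg⟩ : ∃ ε : ℤ, (ε = 1 ∨ ε = -1) ∧ CG p = ε * Q := by
    rcases sq_eq_sq_iff_eq_or_eq_neg.1 h3 with h | h
    · exact ⟨1, Or.inl rfl, by simpa using h⟩
    · exact ⟨-1, Or.inr rfl, by simpa using h⟩
  have h4 := C_sign p hodd _ hω ε (by rw [← CG_eq]; exact hg)
  have h20 : ((2 : ℤ) : ZMod p) ≠ 0 := by
    intro h
    have : ((2 : ℕ) : ZMod p) = 0 := by exact_mod_cast h
    rw [ZMod.natCast_eq_zero_iff] at this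
    exact absurd (Nat.le_of_dvd two_pos this) (by omega)
  have hne : ((1 : ℤ) : ZMod p) ≠ ((-1 : ℤ) : ZMod p) := by
    intro h
    apply h20
    have h' : (1 : ZMod p) = -1 := by exact_mod_cast h
    push_cast
    linear_combination h'
  have h5 : ε * legendreSym p 2 = (-1) ^ (p / 2) := by
    have h4' : ((ε * legendreSym p 2 : ℤ) : ZMod p) = (((-1) ^ (p / 2) : ℤ) : ZMod p) := by
      push_cast; exact h4
    rcases legendreSym.eq_one_or_neg_one p h20 with h | h <;>
    rcases hε with h' | h' <;> rcases neg_one_pow_eq_or ℤ (p / 2) with h'' | h'' <;>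
    rw [h, h', h''] at h4' ⊢ <;> first | rfl | exact absurd h4' hne | exact absurd h4'.symm hne
  have h6 : ε = (-1) ^ (p / 2) * legendreSym p 2 := by
    rw [← h5, mul_assoc, ← sq, legendreSym.sq_one p h20, mul_one]
  rw [hg, hQ, hs3, h6]
  push_cast; ring

lemma CG_one (p : ℕ) [Fact p.Prime] (h : p % 4 = 1) : CG p = (Real.sqrt p : ℝ) := by
  have hodd : Odd p := by rw [Nat.odd_iff]; omega
  have hp2 : p ≠ 2 := by omega
  rw [CG_val p hodd, legendreSym.at_two hp2, ZMod.χ₈_nat_eq_if_mod_eight]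
  obtain ⟨k, hk | hk⟩ : ∃ k, p = 8 * k + 1 ∨ p = 8 * k + 5 := ⟨p / 8, by omega⟩
  · rw [show p / 2 = 4 * k by omega, if_neg (by omega), if_pos (by omega), pow_mul, pow_mul]
    norm_num
  · rw [show p / 2 = 4 * k + 2 by omega, if_neg (by omega), if_neg (by omega), pow_add, pow_mul,
      pow_add, pow_mul]
    norm_num

lemma CG_three (p : ℕ) [Fact p.Prime] (h : p % 4 = 3) : CG p = Complex.I * (Real.sqrt p : ℝ) := by
  have hodd : Odd p := by rw [Nat.odd_iff]; omega
  have hp2 : p ≠ 2 := by omega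
  rw [CG_val p hodd, legendreSym.at_two hp2, ZMod.χ₈_nat_eq_if_mod_eight]
  obtain ⟨k, hk | hk⟩ : ∃ k, p = 8 * k + 3 ∨ p = 8 * k + 7 := ⟨p / 8, by omega⟩
  · rw [show p / 2 = 4 * k + 1 by omega, if_neg (by omega), if_neg (by omega), pow_add, pow_mul,
      pow_add, pow_mul]
    norm_num
  · rw [show p / 2 = 4 * k + 3 by omega, if_neg (by omega), if_pos (by omega), pow_add, pow_mul,
      pow_add, pow_mul]
    norm_num [Complex.I_pow_three]

lemma D_tail (v : ℕ → ℂ) (B : ℝ) (hB : ∀ n, ‖∑ i ∈ Finset.range n, v i‖ ≤ B) (w : ℕ → ℝ)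
    (hw : Antitone w) (hw0 : ∀ n, 0 ≤ w n) (n : ℕ) :
    ‖∑ i ∈ Finset.range n, (w i : ℂ) * v i‖ ≤ B * w 0 := by
  have hB0 : 0 ≤ B := by simpa using hB 0
  rcases n with _ | n
  · simpa using mul_nonneg hB0 (hw0 0)
  have key : ∀ n, ‖∑ i ∈ Finset.range (n + 1), (w i : ℂ) * v i -
      w n * ∑ i ∈ Finset.range (n + 1), v i‖ ≤ B * (w 0 - w n) := by
    intro n
    induction n with
    | zero => simp
    | succ n ih =>
      have e : ∑ i ∈ Finset.range (n + 1 + 1), (w i : ℂ) * v i -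
        w (n + 1) * ∑ i ∈ Finset.range (n + 1 + 1), v i =
        (∑ i ∈ Finset.range (n + 1), (w i : ℂ) * v i - w n * ∑ i ∈ Finset.range (n + 1), v i) +
          ((w n - w (n + 1) : ℝ) : ℂ) * ∑ i ∈ Finset.range (n + 1), v i := by
        rw [Finset.sum_range_succ (fun i => (w i : ℂ) * v i) (n + 1), Finset.sum_range_succ v (n + 1)]
        push_cast; ring
      rw [e]
      refine (norm_add_le _ _).trans ?_
      rw [norm_mul, Complex.norm_real, Real.norm_of_nonneg (sub_nonneg.2 (hw n.le_succ))]
      have := mul_le_mul_of_nonneg_left (hB (n + 1)) (sub_nonneg.2 (hw n.le_succ))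
      simp only [Nat.succ_eq_add_one] at this ⊢
      linarith
  have h1 := key n
  have h2 : ‖(w n : ℂ) * ∑ i ∈ Finset.range (n + 1), v i‖ ≤ w n * B := by
    rw [norm_mul, Complex.norm_real, Real.norm_of_nonneg (hw0 n)]
    exact mul_le_mul_of_nonneg_left (hB _) (hw0 n)
  calc _ = ‖(∑ i ∈ Finset.range (n + 1), (w i : ℂ) * v i -
      w n * ∑ i ∈ Finset.range (n + 1), v i) + (w n : ℂ) * ∑ i ∈ Finset.range (n + 1), v i‖ := by
        rw [sub_add_cancel]
    _ ≤ _ := (norm_add_le _ _).trans (by linarith)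

open Filter Topology in
lemma D_lim {ι : Type*} (l : Filter ι) [l.NeBot] (u : ℕ → ℂ) (C : ℝ)
    (hC : ∀ n, ‖∑ i ∈ Finset.range n, u i‖ ≤ C) (w : ι → ℕ → ℝ)
    (hw : ∀ᶠ i in l, Antitone (w i) ∧ (∀ n, 0 ≤ w i n) ∧ (∀ n, w i n ≤ 1 / ((n : ℝ) + 1)))
    (hlim : ∀ n, Tendsto (fun i => w i n) l (𝓝 (1 / ((n : ℝ) + 1))))
    (L : ι → ℂ) (hL : ∀ᶠ i in l, HasSum (fun n => (w i n : ℂ) * u n) (L i)) (ℓ : ℂ)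
    (hℓ : Tendsto L l (𝓝 ℓ)) :
    Tendsto (fun M => ∑ n ∈ Finset.range M, ((1 / ((n : ℝ) + 1) : ℝ) : ℂ) * u n) atTop (𝓝 ℓ) := by
  have hC0 : 0 ≤ C := by simpa using hC 0
  have hb : ∀ M : ℕ, ‖ℓ - ∑ n ∈ Finset.range M, ((1 / ((n : ℝ) + 1) : ℝ) : ℂ) * u n‖ ≤
      2 * C * (1 / ((M : ℝ) + 1)) := by
    intro M
    have ht : Tendsto (fun i => ‖L i - ∑ n ∈ Finset.range M, (w i n : ℂ) * u n‖) l
        (𝓝 ‖ℓ - ∑ n ∈ Finset.range M, ((1 / ((n : ℝ) + 1) : ℝ) : ℂ) * u n‖) := by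
      refine (hℓ.sub (tendsto_finsetSum _ fun n _ => ?_)).norm
      exact ((Complex.continuous_ofReal.tendsto _).comp (hlim n)).mul_const _
    refine le_of_tendsto ht ?_
    filter_upwards [hw, hL] with i ⟨h1, h2, h3⟩ h4
    have h5 := ((hasSum_nat_add_iff' M).2 h4).tendsto_sum_nat.norm
    refine le_of_tendsto h5 (Eventually.of_forall fun n => ?_)
    have h6 := D_tail (fun k => u (k + M)) (2 * C) (fun n => ?_) (fun k => w i (k + M))
      (fun a b hab => h1 (by omega)) (fun n => h2 _) n
    · refine h6.trans ?_
      rw [zero_add]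
      exact mul_le_mul_of_nonneg_left (h3 M) (by positivity)
    · have e : ∑ k ∈ Finset.range n, u (k + M) = ∑ k ∈ Finset.range (M + n), u k - ∑ k ∈ Finset.range M, u k := by
        rw [Finset.sum_range_add]; simp [add_comm]
      rw [e]
      refine (norm_sub_le _ _).trans ?_
      linarith [hC (M + n), hC M]
  rw [tendsto_iff_norm_sub_tendsto_zero]
  refine squeeze_zero (fun _ => norm_nonneg _) (fun M => (norm_sub_rev _ _).trans_le (hb M)) ?_
  simpa using (tendsto_one_div_add_atTop_nhds_zero_nat (𝕜 := ℝ)).const_mul (2 * C)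

open Filter Topology HurwitzZeta in
lemma D_expZeta (t : ℝ) (ht : Complex.exp (2 * Real.pi * Complex.I * t) ≠ 1) :
    expZeta t 1 = - Complex.log (1 - Complex.exp (2 * Real.pi * Complex.I * t)) := by
  set z := Complex.exp (2 * Real.pi * Complex.I * t) with hz
  have hzn : ‖z‖ = 1 := by
    rw [hz, show 2 * (Real.pi : ℂ) * Complex.I * t = ((2 * Real.pi * t : ℝ) : ℂ) * Complex.I by
      push_cast; ring, Complex.norm_exp_ofReal_mul_I]
  have hz1 : 0 < ‖z - 1‖ := norm_pos_iff.2 (sub_ne_zero.2 ht)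
  have hC : ∀ n, ‖∑ i ∈ Finset.range n, z ^ (i + 1)‖ ≤ 2 / ‖z - 1‖ := by
    intro n
    have : ∑ i ∈ Finset.range n, z ^ (i + 1) = z * ((z ^ n - 1) / (z - 1)) := by
      rw [← geom_sum_eq ht, Finset.mul_sum]; simp [pow_succ']
    rw [this, norm_mul, hzn, one_mul, norm_div]
    gcongr
    refine (norm_sub_le _ _).trans ?_
    rw [norm_pow, hzn]; norm_num
  have ht0 : (t : UnitAddCircle) ≠ 0 := by
    rw [Ne, AddCircle.coe_eq_zero_iff]
    rintro ⟨n, hn⟩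
    apply ht
    rw [hz, ← hn, Complex.exp_eq_one_iff]
    exact ⟨n, by simp; ring⟩
  have h1 := D_lim (𝓝[>] (1 : ℝ)) (fun n => z ^ (n + 1)) _ hC (fun s n => ((n : ℝ) + 1) ^ (-s)) ?_ ?_
    (fun s => expZeta t (s : ℂ)) ?_ (expZeta t 1) ?_
  have h2 := D_lim (𝓝[<] (1 : ℝ)) (fun n => z ^ (n + 1)) _ hC (fun x n => x ^ (n + 1) / ((n : ℝ) + 1)) ?_ ?_
    (fun x => - Complex.log (1 - z * x)) ?_ (- Complex.log (1 - z)) ?_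
  · exact tendsto_nhds_unique h1 h2
  · have : ∀ᶠ x : ℝ in 𝓝[<] (1 : ℝ), x ∈ Set.Ioo (0 : ℝ) 1 := Ioo_mem_nhdsLT (by norm_num)
    filter_upwards [this] with x hx
    refine ⟨antitone_nat_of_succ_le fun n => ?_, fun n => ?_, fun n => ?_⟩
    · have h0 := hx.1.le
      have := hx.2.le
      apply div_le_div₀ (by positivity) (pow_le_pow_of_le_one h0 this (by omega)) (by positivity)
      push_cast; linarith
    · have := hx.1; positivity
    · gcongr
      exact pow_le_one₀ hx.1.le hx.2.le
  · intro n
    apply tendsto_nhdsWithin_of_tendsto_nhds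
    have : Continuous (fun x : ℝ => x ^ (n + 1) / ((n : ℝ) + 1)) := by fun_prop
    simpa using this.tendsto 1
  · have : ∀ᶠ x : ℝ in 𝓝[<] (1 : ℝ), x ∈ Set.Ioo (0 : ℝ) 1 := Ioo_mem_nhdsLT (by norm_num)
    filter_upwards [this] with x hx
    have hn : ‖z * x‖ < 1 := by
      rw [norm_mul, hzn, one_mul, Complex.norm_real, Real.norm_of_nonneg hx.1.le]; exact hx.2
    have := (hasSum_nat_add_iff' 1).2 (Complex.hasSum_taylorSeries_neg_log hn)
    simp only [Finset.range_one, Finset.sum_singleton, Nat.cast_zero, div_zero, sub_zero] at this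
    refine Eq.mp (congrArg (fun f => HasSum f _) (funext fun n => ?_)) this
    symm
    push_cast
    rw [mul_pow]; ring
  · apply tendsto_nhdsWithin_of_tendsto_nhds
    have hs : 1 - z * (1 : ℝ) ∈ Complex.slitPlane := by
      rw [Complex.mem_slitPlane_iff]
      by_contra hcon
      push Not at hcon
      obtain ⟨h1, h2⟩ := hcon
      simp only [Complex.ofReal_one, mul_one, Complex.sub_re, Complex.one_re, Complex.sub_im, Complex.one_im] at h1 h2
      have h3 : z.re ≤ 1 := hzn ▸ Complex.re_le_norm z
      apply ht
      apply Complex.ext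
      · simp; linarith
      · simp; linarith
    have hc : ContinuousAt (fun x : ℝ => - Complex.log (1 - z * x)) 1 := by
      apply ContinuousAt.neg
      exact ContinuousAt.clog (f := fun x : ℝ => 1 - z * x) (by fun_prop) hs
    simpa using hc.tendsto
  · filter_upwards [self_mem_nhdsWithin] with s hs
    have hs : 1 < s := hs
    refine ⟨antitone_nat_of_succ_le fun n => ?_, fun n => ?_, fun n => ?_⟩
    · apply Real.rpow_le_rpow_of_nonpos (by positivity) _ (by linarith)
      push_cast; linarith
    · positivity
    · rw [one_div, ← Real.rpow_neg_one]
      apply Real.rpow_le_rpow_of_exponent_le _ (by linarith)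
      have : (0:ℝ) ≤ n := by positivity
      linarith
  · intro n
    apply tendsto_nhdsWithin_of_tendsto_nhds
    have hc : ContinuousAt (fun s : ℝ => ((n : ℝ) + 1) ^ (-s)) 1 := by
      apply ContinuousAt.rpow continuousAt_const (by fun_prop)
      left; positivity
    have := hc.tendsto
    rwa [Real.rpow_neg_one, ← one_div] at this
  · filter_upwards [self_mem_nhdsWithin] with s hs
    have hs : 1 < s := hs
    have := (hasSum_nat_add_iff' 1).2 (hasSum_expZeta_of_one_lt_re t (s := s) (by simpa using hs))
    have hs0 : (s : ℂ) ≠ 0 := by exact_mod_cast (by linarith : s ≠ 0)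
    simp only [Finset.range_one, Finset.sum_singleton, Nat.cast_zero, Complex.zero_cpow hs0, div_zero, sub_zero] at this
    refine Eq.mp (congrArg (fun f => HasSum f _) (funext fun n => ?_)) this
    symm
    rw [hz, ← Complex.exp_nat_mul, Complex.ofReal_cpow (by positivity), div_eq_mul_inv, ← Complex.cpow_neg, mul_comm]
    push_cast
    congr 2
    ring
  · apply tendsto_nhdsWithin_of_tendsto_nhds
    have := (differentiable_expZeta_of_ne_zero ht0).continuous.comp Complex.continuous_ofReal
    simpa [Function.comp_def] using this.tendsto 1

lemma D_log (t : ℝ) (h0 : 0 < t) (h1 : t < 1) :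
    Complex.log (1 - Complex.exp (2 * Real.pi * Complex.I * t)) =
      Real.log (2 * Real.sin (Real.pi * t)) + Real.pi * (t - 1 / 2) * Complex.I := by
  have hpi := Real.pi_pos
  have hs : 0 < 2 * Real.sin (Real.pi * t) := by
    apply mul_pos two_pos
    apply Real.sin_pos_of_pos_of_lt_pi (by positivity)
    nlinarith
  have e : 1 - Complex.exp (2 * Real.pi * Complex.I * t) =
      ((2 * Real.sin (Real.pi * t) : ℝ) : ℂ) * Complex.exp (Real.pi * (t - 1 / 2) * Complex.I) := by
    push_cast
    rw [Complex.sin]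
    have e1 : Complex.exp (Real.pi * (t - 1 / 2) * Complex.I) = Complex.exp (Real.pi * t * Complex.I) * (- Complex.I) := by
      rw [← Complex.exp_neg_pi_div_two_mul_I, ← Complex.exp_add]; congr 1; ring
    have e2 : Complex.exp (2 * Real.pi * Complex.I * t) = Complex.exp (Real.pi * t * Complex.I) ^ 2 := by
      rw [← Complex.exp_nat_mul]; congr 1; push_cast; ring
    have e3 : Complex.exp (-(Real.pi * t) * Complex.I) * Complex.exp (Real.pi * t * Complex.I) = 1 := by
      rw [← Complex.exp_add]; simp
    rw [e1, e2]
    linear_combination (Complex.I * Complex.I) * e3 + (1 - Complex.exp (Real.pi * t * Complex.I) ^ 2) * Complex.I_mul_I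
  rw [e, Complex.log_ofReal_mul hs (Complex.exp_ne_zero _), Complex.log_exp]
  · simp; nlinarith
  · simp; nlinarith

noncomputable def De (t : ℝ) : ℂ := Complex.exp (2 * Real.pi * Complex.I * t)

lemma De_pow (t : ℝ) (n : ℕ) : De t ^ n = Complex.exp (2 * Real.pi * Complex.I * t * n) := by
  unfold De; rw [← Complex.exp_nat_mul]; congr 1; ring

lemma De_add (s t : ℝ) : De (s + t) = De s * De t := by
  unfold De; rw [← Complex.exp_add]; congr 1; push_cast; ring

lemma De_fract (t : ℝ) : De (Int.fract t) = De t := by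
  have : De t = De (Int.fract t) * De (⌊t⌋ : ℝ) := by rw [← De_add, Int.fract_add_floor]
  rw [this]
  have : De (⌊t⌋ : ℝ) = 1 := by
    unfold De; rw [Complex.exp_eq_one_iff]; exact ⟨⌊t⌋, by push_cast; ring⟩
  rw [this, mul_one]

lemma De_ne (t : ℝ) (ht : Int.fract t ≠ 0) : De t ≠ 1 := by
  unfold De
  rw [Ne, Complex.exp_eq_one_iff]
  rintro ⟨n, hn⟩
  have h2 : (2 * (Real.pi : ℂ) * Complex.I) ≠ 0 := Complex.two_pi_I_ne_zero
  have : (t : ℂ) = n := by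
    apply mul_left_cancel₀ h2; rw [hn]; ring
  have : t = n := by exact_mod_cast this
  apply ht; rw [this]; simp

lemma De_conj (t : ℝ) : (starRingEnd ℂ) (De t) = De (-t) := by
  unfold De
  rw [← Complex.exp_conj]; congr 1
  have : (starRingEnd ℂ) 2 = 2 := Complex.conj_ofNat 2
  simp [this]

lemma De_norm (t : ℝ) : ‖De t‖ = 1 := by
  unfold De
  rw [show 2 * (Real.pi : ℂ) * Complex.I * t = ((2 * Real.pi * t : ℝ) : ℂ) * Complex.I by
      push_cast; ring, Complex.norm_exp_ofReal_mul_I]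

lemma De_log_conj (t : ℝ) : (starRingEnd ℂ) (Complex.log (1 - De t)) = Complex.log (1 - De (-t)) := by
  rw [← De_conj, ← map_one (starRingEnd ℂ), ← map_sub, Complex.log_conj]
  · simp
  · rw [Ne, Complex.arg_eq_pi_iff]
    have := (De_norm t) ▸ Complex.re_le_norm (De t)
    simp
    intro h; linarith

lemma De_log_im (t : ℝ) (ht : Int.fract t ≠ 0) :
    (Complex.log (1 - De t)).im = Real.pi * (Int.fract t - 1 / 2) := by
  have h0 : 0 < Int.fract t := lt_of_le_of_ne (Int.fract_nonneg t) (Ne.symm ht)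
  rw [← De_fract]
  unfold De
  rw [D_log _ h0 (Int.fract_lt_one t)]
  simp

open Filter Topology HurwitzZeta in
lemma D_L {ι : Type*} [Fintype ι] (c : ι → ℂ) (t : ι → ℝ) (ψ : ℕ → ℂ)
    (hψ : ∀ n, ψ n = ∑ i, c i * De (t i) ^ n) (ht : ∀ i, c i = 0 ∨ De (t i) ≠ 1) :
    Tendsto (fun s : ℝ => LSeries ψ s) (𝓝[>] 1) (𝓝 (-∑ i, c i * Complex.log (1 - De (t i)))) := by
  have h1 : Tendsto (fun s : ℝ => ∑ i, c i * expZeta (t i) (s : ℂ)) (𝓝[>] 1)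
      (𝓝 (-∑ i, c i * Complex.log (1 - De (t i)))) := by
    rw [← Finset.sum_neg_distrib]
    refine tendsto_finsetSum _ fun i _ => ?_
    rcases ht i with h | h
    · simp [h]
    · rw [← mul_neg]
      refine Tendsto.const_mul _ ?_
      have h2 := D_expZeta (t i) h
      unfold De
      rw [← h2]
      have ht0 : (t i : UnitAddCircle) ≠ 0 := by
        rw [Ne, AddCircle.coe_eq_zero_iff]
        rintro ⟨n, hn⟩
        apply h
        unfold De
        rw [← hn, Complex.exp_eq_one_iff]
        exact ⟨n, by simp; ring⟩
      apply tendsto_nhdsWithin_of_tendsto_nhds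
      have := (differentiable_expZeta_of_ne_zero ht0).continuous.comp Complex.continuous_ofReal
      simpa [Function.comp_def] using this.tendsto 1
  refine h1.congr' ?_
  filter_upwards [self_mem_nhdsWithin] with s hs
  have hs : 1 < s := hs
  have hs0 : (s : ℂ) ≠ 0 := by exact_mod_cast (by linarith : s ≠ 0)
  have h3 : HasSum (fun n : ℕ => ∑ i, c i * (Complex.exp (2 * Real.pi * Complex.I * t i * n) / (n : ℂ) ^ (s : ℂ)))
      (∑ i, c i * expZeta (t i) (s : ℂ)) :=
    hasSum_sum fun i _ => (hasSum_expZeta_of_one_lt_re (t i) (s := s) (by simpa using hs)).mul_left (c i)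
  rw [← h3.tsum_eq, LSeries]
  refine tsum_congr fun n => ?_
  rw [LSeries.term_def]
  split_ifs with h0
  · subst h0; simp [hs0]
  · rw [hψ n, Finset.sum_div]
    refine Finset.sum_congr rfl fun i _ => ?_
    rw [De_pow]; ring

lemma D_std (p : ℕ) [Fact p.Prime] (a : ZMod p) (c : ℝ) :
    De (c - a.val / p) = De c * ZMod.stdAddChar (-a) := by
  have h : a = ((a.val : ℤ) : ZMod p) := by simp
  conv_rhs => rw [h, ← Int.cast_neg, ZMod.stdAddChar_coe]
  rw [sub_eq_add_neg, De_add]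
  congr 1
  unfold De
  congr 1; push_cast; ring

lemma D_four (p : ℕ) [Fact p.Prime] (hodd : Odd p) (b : ZMod p) :
    ∑ a : ZMod p, (quadraticChar (ZMod p) a : ℂ) * ZMod.stdAddChar (-a * b) =
      quadraticChar (ZMod p) (-b) * CG p := by
  have hp2 : p ≠ 2 := by rintro rfl; exact absurd hodd (by decide)
  have hq : ringChar (ZMod p) ≠ 2 := by rwa [ZMod.ringChar_zmod_n]
  by_cases hb : b = 0
  · subst hb
    have := quadraticChar_sum_zero hq
    have h2 : ((∑ a : ZMod p, quadraticChar (ZMod p) a : ℤ) : ℂ) = 0 := by rw [this]; simp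
    push_cast at h2
    simp only [mul_zero, AddChar.map_zero_eq_one, mul_one, neg_zero, h2]
    simp
  · unfold CG
    rw [Finset.mul_sum]
    refine Fintype.sum_equiv (Equiv.mulRight₀ (-b) (neg_ne_zero.2 hb)) _ _ fun a => ?_
    show (quadraticChar (ZMod p) a : ℂ) * ZMod.stdAddChar (-a * b) = (quadraticChar (ZMod p) (-b) : ℂ) *
      ((quadraticChar (ZMod p) (a * -b) : ℂ) * ZMod.stdAddChar (a * -b))
    rw [map_mul (quadraticChar (ZMod p))]
    have : (quadraticChar (ZMod p) (-b) : ℂ) * quadraticChar (ZMod p) (-b) = 1 := by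
      have := quadraticChar_sq_one (neg_ne_zero.2 hb)
      rw [sq] at this
      exact_mod_cast this
    rw [show a * -b = -a * b by ring]
    push_cast
    linear_combination (-(quadraticChar (ZMod p) a : ℂ) * ZMod.stdAddChar (-a * b)) * this

lemma D_std_pow (p : ℕ) [Fact p.Prime] (a : ZMod p) (c : ℝ) (n : ℕ) :
    De (c - a.val / p) ^ n = De c ^ n * ZMod.stdAddChar (-a * (n : ZMod p)) := by
  rw [D_std, mul_pow, ← AddChar.map_nsmul_eq_pow, nsmul_eq_mul, mul_comm (-a)]

lemma D_qc (p : ℕ) [Fact p.Prime] (n : ℕ) : quadraticChar (ZMod p) (n : ZMod p) = legendreSym p n := by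
  simp [legendreSym]

noncomputable def DY (p : ℕ) [Fact p.Prime] (c : ℝ) : ℂ :=
  ∑ a : ZMod p, (quadraticChar (ZMod p) a : ℂ) * Complex.log (1 - De (c - a.val / p))

lemma DY_conj (p : ℕ) [Fact p.Prime] (c : ℝ) :
    (starRingEnd ℂ) (DY p c) = quadraticChar (ZMod p) (-1) * DY p (-c) := by
  unfold DY
  rw [map_sum, Finset.mul_sum]
  refine Fintype.sum_equiv (Equiv.neg _) _ _ fun a => ?_
  rw [map_mul, De_log_conj, D_std, Equiv.neg_apply, neg_neg, neg_sub, show (a.val / p - c : ℝ) = -c + a.val / p by ring, De_add]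
  have e : De (a.val / p) = ZMod.stdAddChar a := by
    have := D_std p (-a) 0
    rw [neg_neg] at this
    have h2 := D_std p a 0
    have h3 : De 0 = 1 := by simp [De]
    rw [h3, one_mul] at h2
    rw [zero_sub, ← De_conj] at h2
    rw [← Complex.conj_conj (De (a.val / p)), h2, ZMod.stdAddChar_apply, ZMod.stdAddChar_apply,
      AddChar.map_neg_eq_inv, ← Circle.coe_inv_eq_conj, inv_inv]
  rw [e, ← mul_assoc]
  congr 1
  rw [← Int.cast_mul, ← map_mul]; simp

lemma DY_im (p : ℕ) [Fact p.Prime] (hodd : Odd p) (c : ℚ)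
    (hc : ∀ a ∈ Finset.range p, a ≠ 0 → Int.fract (c - (a : ℚ) / p) ≠ 0) :
    (DY p c).im = Real.pi * (AX p c : ℚ) := by
  have hcast : ∀ q : ℚ, Int.fract (q : ℝ) = ((Int.fract q : ℚ) : ℝ) := fun q => (Rat.cast_fract q).symm
  have h0 : (∑ a ∈ Finset.range p, (legendreSym p a : ℝ)) = 0 := by
    exact_mod_cast congrArg (fun q : ℚ => (q : ℝ)) (A_leg_sum p hodd)
  unfold DY AX
  rw [← C_sum_zmod p, Complex.im_sum]
  push_cast
  rw [Finset.mul_sum]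
  have : ∀ a ∈ Finset.range p, ((quadraticChar (ZMod p) (a : ZMod p) : ℂ) *
      Complex.log (1 - De (c - ((a : ZMod p).val : ℝ) / p))).im =
      Real.pi * ((legendreSym p a : ℝ) * ((Int.fract (c - (a : ℚ) / p) : ℚ) : ℝ)) -
        Real.pi / 2 * (legendreSym p a : ℝ) := by
    intro a ha
    rw [ZMod.val_cast_of_lt (Finset.mem_range.1 ha)]
    have e : quadraticChar (ZMod p) (a : ZMod p) = legendreSym p a := by simp [legendreSym]
    rw [e]
    by_cases ha0 : a = 0
    · subst ha0; simp
    · have h1 := hc a ha ha0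
      have h2 : ((c : ℝ) - (a : ℝ) / p) = ((c - (a : ℚ) / p : ℚ) : ℝ) := by push_cast; rfl
      have h3 : Int.fract ((c : ℝ) - (a : ℝ) / p) ≠ 0 := by
        rw [h2, hcast]; exact_mod_cast h1
      rw [← Complex.ofReal_intCast, Complex.im_ofReal_mul, De_log_im _ h3, h2, hcast]
      ring
  rw [Finset.sum_congr rfl this, Finset.sum_sub_distrib, ← Finset.mul_sum _ _ (Real.pi / 2), h0]
  simp

open Filter Topology in
lemma D_three (p : ℕ) [Fact p.Prime] (h : p % 4 = 3) :
    Tendsto (fun s : ℝ => LSeries (fun n => (legendreSym p n : ℂ)) s) (𝓝[>] 1)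
      (𝓝 ((Real.pi / Real.sqrt p * (hpStar p : ℚ) : ℝ) : ℂ)) := by
  have hodd : Odd p := by rw [Nat.odd_iff]; omega
  have hp2 : p ≠ 2 := by omega
  have hpp : 0 < p := (Fact.out : p.Prime).pos
  have hq : ringChar (ZMod p) ≠ 2 := by rwa [ZMod.ringChar_zmod_n]
  have hm : quadraticChar (ZMod p) (-1) = -1 := by
    rw [quadraticChar_neg_one hq, ZMod.card, ZMod.χ₄_nat_three_mod_four h]
  have hs : (Real.sqrt p : ℂ) ≠ 0 := by
    have : 0 < Real.sqrt p := Real.sqrt_pos.2 (by exact_mod_cast hpp)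
    exact_mod_cast this.ne'
  have hg : CG p ≠ 0 := by rw [CG_three p h]; exact mul_ne_zero Complex.I_ne_zero hs
  have hc : ∀ a ∈ Finset.range p, a ≠ 0 → Int.fract ((0 : ℚ) - (a : ℚ) / p) ≠ 0 := by
    intro a ha h0 hf
    rw [Int.fract_eq_zero_iff] at hf
    obtain ⟨n, hn⟩ := hf
    have hp' : (p : ℚ) ≠ 0 := by positivity
    have : (a : ℚ) = -(n * p) := by rw [hn]; field_simp; ring
    have : (a : ℤ) = -(n * p) := by exact_mod_cast this
    have h2 : (p : ℤ) ∣ a := ⟨-n, by rw [this]; ring⟩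
    have h3 := Nat.le_of_dvd (Nat.pos_of_ne_zero h0) (Int.natCast_dvd_natCast.1 h2)
    have := Finset.mem_range.1 ha
    omega
  have hL := D_L (fun a : ZMod p => -(quadraticChar (ZMod p) a : ℂ) / CG p) (fun a => (0 : ℝ) - a.val / p)
    (fun n => (legendreSym p n : ℂ)) ?_ ?_
  · convert hL using 2
    have e1 : DY p 0 = Complex.I * (Real.pi * (hpStar p : ℚ) : ℝ) := by
      have h1 := DY_im p hodd 0 hc
      have h2 := DY_conj p 0
      rw [hm, neg_zero] at h2
      rw [AX_zero p hodd] at h1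
      have h3 : (DY p 0).re = 0 := by
        have := congrArg Complex.re h2
        simp at this; linarith
      apply Complex.ext
      · simp [h3]
      · rw [Rat.cast_zero] at h1; rw [h1]; simp
    have e2 : -∑ i : ZMod p, -(quadraticChar (ZMod p) i : ℂ) / CG p * Complex.log (1 - De (0 - i.val / p)) =
        DY p 0 / CG p := by
      unfold DY
      rw [Finset.sum_div, ← Finset.sum_neg_distrib]
      exact Finset.sum_congr rfl fun a _ => by ring
    rw [e2, e1, CG_three p h]
    push_cast
    field_simp
  · intro n
    have h1 := D_four p hodd (n : ZMod p)
    rw [← neg_one_mul (n : ZMod p), map_mul, hm] at h1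
    have e : ∑ a : ZMod p, -(quadraticChar (ZMod p) a : ℂ) / CG p * De (0 - a.val / p) ^ n =
        -(1 / CG p) * ∑ a : ZMod p, (quadraticChar (ZMod p) a : ℂ) * ZMod.stdAddChar (-a * (n : ZMod p)) := by
      rw [Finset.mul_sum]
      refine Finset.sum_congr rfl fun a _ => ?_
      rw [D_std_pow]
      have h3 : De 0 = 1 := by simp [De]
      rw [h3]; ring
    rw [e, h1, D_qc]
    push_cast
    field_simp
  · intro a
    by_cases ha : a = 0
    · left; simp [ha]
    · right
      apply De_ne
      have := hc a.val (Finset.mem_range.2 (ZMod.val_lt a)) (by simpa using ha)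
      intro h2
      apply this
      have h3 : ((0 : ℝ) - (a.val : ℝ) / p) = ((0 - (a.val : ℚ) / p : ℚ) : ℝ) := by push_cast; rfl
      rw [h3, ← Rat.cast_fract] at h2
      exact_mod_cast h2

lemma De_quarter : De (1 / 4) = Complex.I := by
  unfold De
  have : (2 * Real.pi * Complex.I * ((1 / 4 : ℝ) : ℂ)) = Real.pi / 2 * Complex.I := by push_cast; ring
  rw [this, Complex.exp_pi_div_two_mul_I]

lemma De_neg_quarter : De (-1 / 4) = -Complex.I := by
  unfold De
  have : (2 * Real.pi * Complex.I * ((-1 / 4 : ℝ) : ℂ)) = -Real.pi / 2 * Complex.I := by push_cast; ring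
  rw [this, Complex.exp_neg_pi_div_two_mul_I]

lemma D_chi4 (n : ℕ) : Complex.I ^ n - (-Complex.I) ^ n = 2 * Complex.I * (ZMod.χ₄ n : ℤ) := by
  have hn := Nat.div_add_mod n 4
  have h4 : Complex.I ^ 4 = 1 := Complex.I_pow_four
  have h4' : (-Complex.I) ^ 4 = 1 := by rw [neg_pow, h4]; norm_num
  have hlt : n % 4 < 4 := Nat.mod_lt _ (by norm_num)
  rw [ZMod.χ₄_nat_mod_four]
  conv_lhs => rw [← hn]
  rw [pow_add, pow_add, pow_mul, pow_mul, h4, h4', one_pow, one_mul, one_mul]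
  interval_cases (n % 4)
  · simp
  · simp [ZMod.χ₄_nat_one_mod_four (n := 1) rfl]; ring
  · have : ZMod.χ₄ ((2 : ℕ) : ZMod 4) = 0 := by decide
    rw [this]; simp
  · have : ZMod.χ₄ ((3 : ℕ) : ZMod 4) = -1 := by decide
    rw [this, neg_pow]; simp [Complex.I_pow_three]; ring

open Filter Topology in
lemma D_one (p : ℕ) [Fact p.Prime] (h : p % 4 = 1) :
    Tendsto (fun s : ℝ => LSeries (fun n => (ZMod.χ₄ n : ℂ) * (legendreSym p n : ℂ)) s) (𝓝[>] 1)
      (𝓝 ((Real.pi / Real.sqrt p * (AX p (-1 / 4) : ℚ) : ℝ) : ℂ)) := by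
  have hodd : Odd p := by rw [Nat.odd_iff]; omega
  have hp2 : p ≠ 2 := by omega
  have hpp : 0 < p := (Fact.out : p.Prime).pos
  have hq : ringChar (ZMod p) ≠ 2 := by rwa [ZMod.ringChar_zmod_n]
  have hm : quadraticChar (ZMod p) (-1) = 1 := by
    rw [quadraticChar_neg_one hq, ZMod.card, ZMod.χ₄_nat_one_mod_four h]
  have hs : (Real.sqrt p : ℂ) ≠ 0 := by
    have : 0 < Real.sqrt p := Real.sqrt_pos.2 (by exact_mod_cast hpp)
    exact_mod_cast this.ne'
  have hg : CG p ≠ 0 := by rw [CG_one p h]; exact hs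
  have hI := Complex.I_ne_zero
  have hc : ∀ ε : ℤ, ε = 1 ∨ ε = -1 → ∀ a : ℕ, Int.fract ((ε / 4 : ℚ) - (a : ℚ) / p) ≠ 0 := by
    intro ε hε a hf
    rw [Int.fract_eq_zero_iff] at hf
    obtain ⟨n, hn⟩ := hf
    have hp' : (p : ℚ) ≠ 0 := by positivity
    have : (ε * p : ℚ) = 4 * a + 4 * p * n := by rw [hn]; field_simp; ring
    have : (ε * p : ℤ) = 4 * a + 4 * p * n := by exact_mod_cast this
    have h2 : (4 : ℤ) ∣ ε * p := ⟨a + p * n, by rw [this]; ring⟩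
    rcases hε with rfl | rfl <;> omega
  have hc' : ∀ ε : ℤ, ε = 1 ∨ ε = -1 → ∀ a : ZMod p, De (ε / 4 - a.val / p) ≠ 1 := by
    intro ε hε a
    apply De_ne
    intro h2
    apply hc ε hε a.val
    have h3 : ((ε / 4 : ℝ) - (a.val : ℝ) / p) = ((ε / 4 - (a.val : ℚ) / p : ℚ) : ℝ) := by push_cast; rfl
    rw [h3, ← Rat.cast_fract] at h2
    exact_mod_cast h2
  have hL := D_L (fun a : ZMod p ⊕ ZMod p => Sum.elim (fun a => (quadraticChar (ZMod p) a : ℂ) / (2 * Complex.I * CG p))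
      (fun a => -(quadraticChar (ZMod p) a : ℂ) / (2 * Complex.I * CG p)) a)
    (fun a => Sum.elim (fun a => (1 / 4 : ℝ) - a.val / p) (fun a => (-1 / 4 : ℝ) - a.val / p) a)
    (fun n => (ZMod.χ₄ n : ℂ) * (legendreSym p n : ℂ)) ?_ ?_
  · convert hL using 2
    rw [Fintype.sum_sum_type]
    simp only [Sum.elim_inl, Sum.elim_inr]
    have e2 : ∑ i : ZMod p, (quadraticChar (ZMod p) i : ℂ) / (2 * Complex.I * CG p) * Complex.log (1 - De (1 / 4 - i.val / p)) =
        DY p (1 / 4) / (2 * Complex.I * CG p) := by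
      unfold DY
      rw [Finset.sum_div]
      exact Finset.sum_congr rfl fun a _ => by ring
    have e3 : ∑ i : ZMod p, -(quadraticChar (ZMod p) i : ℂ) / (2 * Complex.I * CG p) * Complex.log (1 - De (-1 / 4 - i.val / p)) =
        -DY p (-1 / 4) / (2 * Complex.I * CG p) := by
      unfold DY
      rw [← Finset.sum_neg_distrib, Finset.sum_div]
      exact Finset.sum_congr rfl fun a _ => by ring
    rw [e2, e3]
    have h1 := DY_im p hodd (-1 / 4) (fun a _ _ => by
      have := hc (-1) (Or.inr rfl) a
      push_cast at this; exact this)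
    have h2 := DY_conj p (-1 / 4)
    rw [hm, Int.cast_one, one_mul, show -(-1 / 4 : ℝ) = 1 / 4 by norm_num] at h2
    rw [← h2, CG_one p h]
    rw [show (((-1 / 4 : ℚ)) : ℝ) = -1 / 4 by norm_num] at h1
    have h3 := Complex.sub_conj (DY p (-1 / 4))
    rw [h1] at h3
    push_cast at h3 ⊢
    generalize DY p (-1 / 4) = Y at h3 ⊢
    generalize AX p (-1 / 4) = X at h3 ⊢
    field_simp
    linear_combination -h3
  · intro n
    rw [Fintype.sum_sum_type]
    simp only [Sum.elim_inl, Sum.elim_inr]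
    have h1 := D_four p hodd (n : ZMod p)
    rw [← neg_one_mul (n : ZMod p), map_mul, hm, one_mul] at h1
    have e : ∀ c : ℝ, ∀ d : ℂ, ∑ a : ZMod p, d * (quadraticChar (ZMod p) a : ℂ) / (2 * Complex.I * CG p) * De (c - a.val / p) ^ n =
        (d * De c ^ n / (2 * Complex.I * CG p)) * ((legendreSym p n : ℂ) * CG p) := by
      intro c d
      rw [← D_qc, ← h1, Finset.mul_sum]
      refine Finset.sum_congr rfl fun a _ => ?_
      rw [D_std_pow]
      ring
    have e1 := e (1 / 4) 1
    have e2 := e (-1 / 4) (-1)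
    simp only [one_mul, neg_one_mul] at e1 e2
    rw [De_quarter] at e1
    rw [De_neg_quarter] at e2
    rw [e1, e2]
    field_simp
    linear_combination (-(legendreSym p n : ℂ)) * D_chi4 n
  · rintro (a | a)
    · right
      have := hc' 1 (Or.inl rfl) a
      simpa using this
    · right
      have := hc' (-1) (Or.inr rfl) a
      simpa using this

section EE

variable (R : Type*) [CommRing R] [IsDedekindDomain R] [Module.Free ℤ R] [Module.Finite ℤ R] [CharZero R]

open Ideal

/-- number of ideals of given norm -/
noncomputable def EA (n : ℕ) : ℕ := Nat.card {I : Ideal R // absNorm I = n}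

lemma EA_one : EA R 1 = 1 := by
  unfold EA
  rw [Nat.card_eq_one_iff_unique]
  refine ⟨⟨fun a b => Subtype.ext ?_⟩, ⟨⟨⊤, by simp⟩⟩⟩
  rw [absNorm_eq_one_iff.1 a.2, absNorm_eq_one_iff.1 b.2]

lemma E_cop {m n : ℕ} (h : m.Coprime n) (I J : Ideal R) (hI : absNorm I = m) (hJ : absNorm J = n) :
    IsCoprime I J := by
  rw [Ideal.isCoprime_iff_exists]
  have h1 : (m : R) ∈ I := hI ▸ absNorm_mem I
  have h2 : (n : R) ∈ J := hJ ▸ absNorm_mem J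
  have := Nat.isCoprime_iff_coprime.2 h
  obtain ⟨a, b, hab⟩ := this
  refine ⟨(a : R) * m, I.mul_mem_left _ h1, (b : R) * n, J.mul_mem_left _ h2, ?_⟩
  exact_mod_cast congrArg (Int.cast : ℤ → R) hab

lemma EA_mul {m n : ℕ} (h : m.Coprime n) : EA R (m * n) = EA R m * EA R n := by
  unfold EA
  rw [← Nat.card_prod]
  symm
  refine Nat.card_congr (Equiv.ofBijective (fun x => ⟨x.1.1 * x.2.1, by rw [map_mul, x.1.2, x.2.2]⟩) ⟨?_, ?_⟩)
  · rintro ⟨⟨I, hI⟩, ⟨J, hJ⟩⟩ ⟨⟨I', hI'⟩, ⟨J', hJ'⟩⟩ e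
    have e : I * J = I' * J' := congrArg Subtype.val e
    have c1 := E_cop R h I J' hI hJ'
    have c2 := E_cop R h I' J hI' hJ
    have d1 : I' ∣ I := c2.dvd_of_dvd_mul_right (e ▸ dvd_mul_right _ _)
    have d2 : I ∣ I' := c1.dvd_of_dvd_mul_right (e ▸ dvd_mul_right _ _)
    have d3 : J' ∣ J := c1.symm.dvd_of_dvd_mul_left (e ▸ dvd_mul_left _ _)
    have d4 : J ∣ J' := c2.symm.dvd_of_dvd_mul_left (e ▸ dvd_mul_left _ _)
    rw [Ideal.dvd_iff_le] at d1 d2 d3 d4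
    have := le_antisymm d1 d2
    have := le_antisymm d3 d4
    subst_vars; rfl
  · rintro ⟨L, hL⟩
    have hmn : (m * n : R) ∈ L := by exact_mod_cast hL ▸ absNorm_mem L
    have hprod : (L ⊔ span {(m : R)}) * (L ⊔ span {(n : R)}) = L := by
      apply le_antisymm
      · rw [Ideal.sup_mul, Ideal.mul_sup, Ideal.mul_sup]
        refine sup_le (sup_le (Ideal.mul_le_inf.trans inf_le_left) (Ideal.mul_le_inf.trans inf_le_left)) (sup_le (Ideal.mul_le_inf.trans inf_le_right) ?_)
        rw [Ideal.span_singleton_mul_span_singleton, Ideal.span_singleton_le_iff_mem]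
        exact hmn
      · intro x hx
        obtain ⟨a, b, hab⟩ := Nat.isCoprime_iff_coprime.2 h
        have hab : (a : R) * m + b * n = 1 := by exact_mod_cast congrArg (Int.cast : ℤ → R) hab
        have e : x = (m : R) * (a * x) + (x * b) * n := by linear_combination -x * hab
        rw [e]
        refine Ideal.add_mem _ (Ideal.mul_mem_mul ?_ ?_) (Ideal.mul_mem_mul ?_ ?_)
        · exact Ideal.mem_sup_right (Ideal.mem_span_singleton_self _)
        · exact Ideal.mem_sup_left (L.mul_mem_left _ hx)
        · exact Ideal.mem_sup_left (L.mul_mem_right _ hx)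
        · exact Ideal.mem_sup_right (Ideal.mem_span_singleton_self _)
    have hN := congrArg absNorm hprod
    rw [map_mul, hL] at hN
    have aux : ∀ k : ℕ, absNorm (L ⊔ span {(k : R)}) ∣ k ^ Module.finrank ℤ R := fun k => by
      rw [← absNorm_span_natCast]; exact absNorm_dvd_absNorm_of_le le_sup_right
    have h1 : absNorm (L ⊔ span {(m : R)}) ∣ m := by
      refine Nat.Coprime.dvd_of_dvd_mul_right ?_ (hN ▸ Nat.dvd_mul_right _ _)
      exact Nat.Coprime.coprime_dvd_left (aux m) (h.pow_left _)
    have h2 : absNorm (L ⊔ span {(n : R)}) ∣ n := by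
      refine Nat.Coprime.dvd_of_dvd_mul_left ?_ (hN ▸ Nat.dvd_mul_left _ _)
      exact Nat.Coprime.coprime_dvd_left (aux n) (h.symm.pow_left _)
    by_cases hz : m * n = 0
    · have : m = 0 ∧ n = 1 ∨ m = 1 ∧ n = 0 := by
        rcases mul_eq_zero.1 hz with h0 | h0
        · left; subst h0; exact ⟨rfl, by simpa using h⟩
        · right; subst h0; exact ⟨by simpa using h, rfl⟩
      rcases this with ⟨rfl, rfl⟩ | ⟨rfl, rfl⟩
      · exact ⟨⟨⟨L, by simpa using hL⟩, ⟨⊤, by simp⟩⟩, Subtype.ext (by simp)⟩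
      · exact ⟨⟨⟨⊤, by simp⟩, ⟨L, by simpa using hL⟩⟩, Subtype.ext (by simp)⟩
    · have hm : 0 < m := Nat.pos_of_ne_zero fun h => hz (by simp [h])
      have hn : 0 < n := Nat.pos_of_ne_zero fun h => hz (by simp [h])
      have l1 := Nat.le_of_dvd hm h1
      have l2 := Nat.le_of_dvd hn h2
      refine ⟨⟨⟨_, ?_⟩, ⟨_, ?_⟩⟩, Subtype.ext hprod⟩
      · nlinarith
      · nlinarith

lemma E_max {l k : ℕ} (hl : l.Prime) (I : Ideal R) (hI : absNorm I = l ^ (k + 1)) :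
    ∃ M : Ideal R, M.IsMaximal ∧ (l : R) ∈ M ∧ ∃ J, I = M * J := by
  have hne : I ≠ ⊤ := by
    rintro rfl
    rw [absNorm_top] at hI
    exact absurd hI (Nat.one_lt_pow (Nat.succ_ne_zero k) hl.one_lt).ne
  obtain ⟨M, hM, hIM⟩ := Ideal.exists_le_maximal I hne
  refine ⟨M, hM, ?_, ?_⟩
  · have : ((l : R) ^ (k + 1)) ∈ I := by exact_mod_cast hI ▸ absNorm_mem I
    exact hM.isPrime.mem_of_pow_mem _ (hIM this)
  · exact Ideal.dvd_iff_le.2 hIM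

variable (hr : Module.finrank ℤ R = 2) {l : ℕ} (hl : l.Prime)
include hr hl

lemma E_zero (h0 : EA R l = 0) (k : ℕ) : EA R (l ^ (k + 2)) = EA R (l ^ k) := by
  have hnot : ∀ I : Ideal R, absNorm I ≠ l := by
    intro I hI
    unfold EA at h0
    have : Finite {I : Ideal R // absNorm I = l} := finite_setOfPred_absNorm_eq l
    rw [Finite.card_eq_zero_iff] at h0
    exact h0.false ⟨I, hI⟩
  have hspan : absNorm (span {(l : R)}) = l ^ 2 := by rw [absNorm_span_natCast, hr]
  have hM : ∀ M : Ideal R, M.IsMaximal → (l : R) ∈ M → M = span {(l : R)} := by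
    intro M hM hlM
    have hle : span {(l : R)} ≤ M := (Ideal.span_singleton_le_iff_mem _).2 hlM
    obtain ⟨J, hJ⟩ := Ideal.dvd_iff_le.2 hle
    have h1 := congrArg absNorm hJ
    rw [map_mul, hspan] at h1
    obtain ⟨i, hi, h2⟩ := (Nat.dvd_prime_pow hl).1 (Dvd.intro _ h1.symm)
    have hi0 : i ≠ 0 := by
      rintro rfl
      exact hM.ne_top (absNorm_eq_one_iff.1 (by simpa using h2))
    have hi1 : i ≠ 1 := by
      rintro rfl
      exact hnot M (by simpa using h2)
    have : i = 2 := by omega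
    subst this
    rw [h2] at h1
    have hJ1 : absNorm J = 1 := by
      have : 0 < l ^ 2 := pow_pos hl.pos 2
      nlinarith
    rw [absNorm_eq_one_iff] at hJ1
    rw [hJ, hJ1, Ideal.mul_top]
  have hl0 : (span {(l : R)}) ≠ 0 := by
    intro h
    rw [h] at hspan
    have : 0 < l ^ 2 := pow_pos hl.pos 2
    simp at hspan; omega
  unfold EA
  symm
  refine Nat.card_congr (Equiv.ofBijective (fun x => ⟨span {(l : R)} * x.1, by
    rw [map_mul, x.2, hspan, ← pow_add, add_comm]⟩) ⟨?_, ?_⟩)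
  · rintro ⟨I, hI⟩ ⟨J, hJ⟩ e
    exact Subtype.ext (mul_left_cancel₀ hl0 (congrArg Subtype.val e))
  · rintro ⟨L, hL⟩
    obtain ⟨M, hMM, hlM, J, hJ⟩ := E_max R (k := k + 1) hl L hL
    rw [hM M hMM hlM] at hJ
    refine ⟨⟨J, ?_⟩, Subtype.ext hJ.symm⟩
    have h1 := congrArg absNorm hJ
    rw [map_mul, hspan, hL, pow_add, mul_comm] at h1
    exact (Nat.eq_of_mul_eq_mul_left (pow_pos hl.pos 2) h1).symm

lemma E_split (h0 : EA R l ≠ 0) : ∃ P Q : Ideal R, absNorm P = l ∧ absNorm Q = l ∧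
    (∀ M : Ideal R, M.IsMaximal → (l : R) ∈ M → M = P ∨ M = Q) ∧ P.IsMaximal ∧ Q.IsMaximal := by
  have hspan : absNorm (span {(l : R)}) = l ^ 2 := by rw [absNorm_span_natCast, hr]
  have hmax : ∀ P : Ideal R, absNorm P = l → P.IsMaximal := by
    intro P hP
    have hp : P.IsPrime := isPrime_of_irreducible_absNorm (hP ▸ hl)
    refine hp.isMaximal ?_
    rintro rfl
    rw [absNorm_bot] at hP
    exact hl.ne_zero hP.symm
  obtain ⟨P, hP⟩ := (Nat.card_ne_zero.1 h0).1
  have hlP : (l : R) ∈ P := by rw [← hP]; exact absNorm_mem P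
  obtain ⟨Q, hQ⟩ := Ideal.dvd_iff_le.2 ((Ideal.span_singleton_le_iff_mem _).2 hlP)
  have hQn : absNorm Q = l := by
    have h1 := congrArg absNorm hQ
    rw [map_mul, hspan, hP, sq] at h1
    exact (Nat.eq_of_mul_eq_mul_left hl.pos h1).symm
  refine ⟨P, Q, hP, hQn, ?_, hmax P hP, hmax Q hQn⟩
  intro M hM hlM
  have h2 : P * Q ≤ M := hQ ▸ (Ideal.span_singleton_le_iff_mem _).2 hlM
  rcases hM.isPrime.mul_le.1 h2 with h3 | h3
  · left; exact ((hmax P hP).eq_of_le hM.ne_top h3).symm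
  · right; exact ((hmax Q hQn).eq_of_le hM.ne_top h3).symm

lemma E_form {P Q : Ideal R} (hP : absNorm P = l) (hQ : absNorm Q = l)
    (hM : ∀ M : Ideal R, M.IsMaximal → (l : R) ∈ M → M = P ∨ M = Q) (k : ℕ) :
    ∀ I : Ideal R, absNorm I = l ^ k → ∃ i ≤ k, I = P ^ i * Q ^ (k - i) := by
  induction k with
  | zero =>
    intro I hI
    exact ⟨0, le_rfl, by simpa [absNorm_eq_one_iff] using hI⟩
  | succ k ih =>
    intro I hI
    obtain ⟨M, hMM, hlM, J, rfl⟩ := E_max R hl I hI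
    have key : absNorm M = l → absNorm J = l ^ k := by
      intro h
      rw [map_mul, h, pow_succ, mul_comm] at hI
      exact Nat.eq_of_mul_eq_mul_right hl.pos hI
    rcases hM M hMM hlM with rfl | rfl
    · obtain ⟨i, hi, rfl⟩ := ih J (key hP)
      refine ⟨i + 1, by omega, ?_⟩
      rw [pow_succ, show k + 1 - (i + 1) = k - i by omega]; ring
    · obtain ⟨i, hi, rfl⟩ := ih J (key hQ)
      refine ⟨i, by omega, ?_⟩
      rw [show k + 1 - i = (k - i) + 1 by omega, pow_succ]; ring

lemma E_one_two : EA R l = 0 ∨ (∀ k, EA R (l ^ k) = 1) ∨ (∀ k, EA R (l ^ k) = k + 1) := by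
  by_cases h0 : EA R l = 0
  · exact Or.inl h0
  right
  obtain ⟨P, Q, hP, hQ, hM, hPm, hQm⟩ := E_split R hr hl h0
  have hP0 : P ≠ 0 := by rintro rfl; simp at hP; exact hl.ne_zero hP.symm
  by_cases hPQ : P = Q
  · left
    subst hPQ
    intro k
    unfold EA
    rw [Nat.card_eq_one_iff_unique]
    have hu : ∀ I : Ideal R, absNorm I = l ^ k → I = P ^ k := by
      intro I hI
      obtain ⟨i, hi, h⟩ := E_form R hr hl hP hQ hM k I hI
      rw [h, ← pow_add]; congr 1; omega
    refine ⟨⟨fun a b => Subtype.ext ?_⟩, ⟨⟨P ^ k, by rw [map_pow, hP]⟩⟩⟩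
    rw [hu _ a.2, hu _ b.2]
  · right
    intro k
    unfold EA
    rw [← Nat.card_fin (k + 1)]
    symm
    refine Nat.card_congr (Equiv.ofBijective (fun i : Fin (k + 1) => ⟨P ^ (i : ℕ) * Q ^ (k - i), by
      rw [map_mul, map_pow, map_pow, hP, hQ, ← pow_add]; congr 1; omega⟩) ⟨?_, ?_⟩)
    · have key : ∀ i j : ℕ, i < j → j ≤ k → P ^ i * Q ^ (k - i) ≠ P ^ j * Q ^ (k - j) := by
        intro i j hij hjk h
        rw [show j = i + (j - i) by omega, pow_add, mul_assoc] at h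
        have h2 := mul_left_cancel₀ (pow_ne_zero i hP0) h
        have h3 : Q ^ (k - i) ≤ P := by
          rw [h2, show j - i = (j - i - 1) + 1 by omega, pow_succ', mul_assoc]
          exact Ideal.mul_le_inf.trans inf_le_left
        have h4 := hPm.isPrime.le_of_pow_le h3
        exact hPQ (hQm.eq_of_le hPm.ne_top h4).symm
      intro i j e
      have e := congrArg Subtype.val e
      simp only at e
      rcases lt_trichotomy (i : ℕ) j with h | h | h
      · exact absurd e (key i j h (by omega))
      · exact Fin.ext h
      · exact absurd e.symm (key j i h (by omega))
    · rintro ⟨I, hI⟩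
      obtain ⟨i, hi, h⟩ := E_form R hr hl hP hQ hM k I hI
      exact ⟨⟨i, by omega⟩, Subtype.ext h.symm⟩

lemma E_pp (ψ : ℤ) (hψ : (EA R l : ℤ) = 1 + ψ) (k : ℕ) :
    (EA R (l ^ k) : ℤ) = ∑ i ∈ Finset.range (k + 1), ψ ^ i := by
  rcases E_one_two R hr hl with h | h | h
  · have : ψ = -1 := by rw [h] at hψ; push_cast at hψ; linarith
    subst this
    induction k using Nat.twoStepInduction with
    | zero => simp [EA_one]
    | one => simp [h]
    | more k ih1 ih2 =>
      rw [E_zero R hr hl h, ih1, Finset.sum_range_succ, Finset.sum_range_succ, Finset.sum_range_succ,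
        Finset.sum_range_succ _ k]
      ring
  · have := h 1
    rw [pow_one] at this
    have : ψ = 0 := by rw [this] at hψ; push_cast at hψ; linarith
    rw [h, this, Finset.sum_range_succ']
    simp
  · have := h 1
    rw [pow_one] at this
    have : ψ = 1 := by rw [this] at hψ; push_cast at hψ; linarith
    rw [h, this]
    simp

end EE

section E2

variable {R : Type*} [CommRing R] (b : Module.Basis (Fin 2) ℤ R) (hb0 : b 0 = 1) (t n : ℤ)
    (hb : b 1 ^ 2 = t * b 1 - n)

lemma E_repr (hb0 : b 0 = 1) (x : R) : x = (b.repr x 0 : R) + (b.repr x 1 : R) * b 1 := by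
  conv_lhs => rw [← b.sum_repr x, Fin.sum_univ_two, hb0]
  simp [zsmul_eq_mul]

lemma E_repr_coord (hb0 : b 0 = 1) (x y : ℤ) : b.repr ((x : R) + y * b 1) 0 = x ∧
    b.repr ((x : R) + y * b 1) 1 = y := by
  have : (x : R) + y * b 1 = x • b 0 + y • b 1 := by rw [hb0]; simp [zsmul_eq_mul]
  rw [this, map_add, map_smul, map_smul, b.repr_self, b.repr_self]
  constructor <;> simp

lemma E_hom {l : ℕ} (hb0 : b 0 = 1) (hb : b 1 ^ 2 = t * b 1 - n) (c : ZMod l) (hc : c ^ 2 - t * c + n = 0) :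
    ∃ φ : R →+* ZMod l, φ (b 1) = c := by
  have hm : ∀ x y : R, b.repr (x * y) 0 = b.repr x 0 * b.repr y 0 - n * (b.repr x 1 * b.repr y 1) ∧
      b.repr (x * y) 1 = b.repr x 0 * b.repr y 1 + b.repr x 1 * b.repr y 0 + t * (b.repr x 1 * b.repr y 1) := by
    intro x y
    have e : x * y = ((b.repr x 0 * b.repr y 0 - n * (b.repr x 1 * b.repr y 1) : ℤ) : R) +
        ((b.repr x 0 * b.repr y 1 + b.repr x 1 * b.repr y 0 + t * (b.repr x 1 * b.repr y 1) : ℤ) : R) * b 1 := by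
      conv_lhs => rw [E_repr b hb0 x, E_repr b hb0 y]
      push_cast
      linear_combination ((b.repr x 1 : R) * b.repr y 1) * hb
    have := E_repr_coord b hb0 (b.repr x 0 * b.repr y 0 - n * (b.repr x 1 * b.repr y 1))
      (b.repr x 0 * b.repr y 1 + b.repr x 1 * b.repr y 0 + t * (b.repr x 1 * b.repr y 1))
    rw [← e] at this
    exact this
  have h1 := E_repr_coord b hb0 1 0
  have hw := E_repr_coord b hb0 0 1
  simp only [Int.cast_one, Int.cast_zero, zero_mul, add_zero, zero_add, one_mul] at h1 hw
  refine ⟨{ toFun := fun x => (b.repr x 0 : ZMod l) + (b.repr x 1 : ZMod l) * c, map_one' := ?_, map_mul' := ?_, map_zero' := ?_, map_add' := ?_ }, ?_⟩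
  · simp [h1]
  · intro x y
    rw [(hm x y).1, (hm x y).2]
    push_cast
    linear_combination (-(b.repr x 1 : ZMod l) * b.repr y 1) * hc
  · simp
  · intro x y
    simp
    ring
  · show (b.repr (b 1) 0 : ZMod l) + (b.repr (b 1) 1 : ZMod l) * c = c
    rw [hw.1, hw.2]; simp

lemma E_hom_ext {l : ℕ} (hb0 : b 0 = 1) (φ φ' : R →+* ZMod l) (h : φ (b 1) = φ' (b 1)) : φ = φ' := by
  ext x
  rw [E_repr b hb0 x]
  simp [h]

lemma E_count {l : ℕ} [Fact l.Prime] [IsDedekindDomain R] [Module.Free ℤ R] (hb0 : b 0 = 1) (hb : b 1 ^ 2 = t * b 1 - n) :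
    EA R l = Nat.card {c : ZMod l // c ^ 2 - t * c + n = 0} := by
  have hl : l.Prime := Fact.out
  unfold EA
  symm
  choose φ hφ using fun c : {c : ZMod l // c ^ 2 - t * c + n = 0} => E_hom b t n hb0 hb c.1 c.2
  refine Nat.card_congr (Equiv.ofBijective (fun c => ⟨RingHom.ker (φ c), ?_⟩) ⟨?_, ?_⟩)
  · rw [Ideal.absNorm_apply, Submodule.cardQuot_apply]
    have := Nat.card_congr (RingHom.quotientKerEquivOfSurjective (ZMod.ringHom_surjective (φ c))).toEquiv
    rw [Nat.card_zmod] at this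
    exact this
  · intro c c' e
    have e : RingHom.ker (φ c) = RingHom.ker (φ c') := congrArg Subtype.val e
    obtain ⟨z, hz⟩ := ZMod.intCast_surjective c.1
    have h1 : b 1 - z ∈ RingHom.ker (φ c) := by
      rw [RingHom.mem_ker, map_sub, hφ, map_intCast, hz, sub_self]
    rw [e, RingHom.mem_ker, map_sub, hφ, map_intCast, hz, sub_eq_zero] at h1
    exact Subtype.ext h1.symm
  · rintro ⟨P, hP⟩
    rw [Ideal.absNorm_apply, Submodule.cardQuot_apply] at hP
    have hfin : Finite (R ⧸ P) := Nat.finite_of_card_ne_zero (by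
      show Nat.card (R ⧸ P) ≠ 0
      rw [hP]; exact hl.ne_zero)
    let _ := Fintype.ofFinite (R ⧸ P)
    let e := ZMod.ringEquivOfPrime (R ⧸ P) hl (by rw [← Nat.card_eq_fintype_card]; exact hP)
    let f : R →+* ZMod l := (e.symm : (R ⧸ P) →+* ZMod l).comp (Ideal.Quotient.mk P)
    have hk : RingHom.ker f = P := by
      ext x
      rw [RingHom.mem_ker]
      simp [f, Ideal.Quotient.eq_zero_iff_mem]
    have hroot : f (b 1) ^ 2 - t * f (b 1) + n = 0 := by
      have := congrArg f hb
      simp at this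
      rw [this]; ring
    refine ⟨⟨f (b 1), hroot⟩, Subtype.ext ?_⟩
    show RingHom.ker (φ ⟨f (b 1), hroot⟩) = P
    rw [← hk]
    congr 1
    exact E_hom_ext b hb0 _ _ (hφ _)

end E2

lemma E_two0 : ∀ z : ZMod 2, (Nat.card {c : ZMod 2 // c ^ 2 - ((0 : ℤ) : ZMod 2) * c + z = 0} : ℤ) =
        1 := by
  simp only [Nat.card_eq_fintype_card]
  decide

lemma E_two1 : ∀ z : ZMod 2, (Nat.card {c : ZMod 2 // c ^ 2 - ((1 : ℤ) : ZMod 2) * c + z = 0} : ℤ) =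
        if z = 0 then 2 else 0 := by
  simp only [Nat.card_eq_fintype_card]
  decide

lemma E_roots (l : ℕ) [Fact l.Prime] (hl : l ≠ 2) (t n : ℤ) :
    (Nat.card {c : ZMod l // c ^ 2 - t * c + n = 0} : ℤ) = 1 + legendreSym l (t ^ 2 - 4 * n) := by
  have h2 : (2 : ZMod l) ≠ 0 := by
    intro h
    have : ((2 : ℕ) : ZMod l) = 0 := by exact_mod_cast h
    rw [ZMod.natCast_eq_zero_iff] at this
    exact hl ((Nat.prime_dvd_prime_iff_eq Fact.out Nat.prime_two).1 this)
  have := legendreSym.card_sqrts l hl (t ^ 2 - 4 * n)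
  rw [add_comm, ← this, Set.toFinset_card, ← Nat.card_eq_fintype_card]
  congr 1
  refine Nat.card_congr (Equiv.ofBijective (fun c => ⟨2 * c.1 - t, ?_⟩) ⟨?_, ?_⟩)
  · show (2 * c.1 - t) ^ 2 = ((t ^ 2 - 4 * n : ℤ) : ZMod l)
    push_cast
    linear_combination 4 * c.2
  · intro c c' e
    have e : 2 * c.1 - t = 2 * c'.1 - t := congrArg Subtype.val e
    exact Subtype.ext (mul_left_cancel₀ h2 (by linear_combination e))
  · rintro ⟨x, hx⟩
    have hx : x ^ 2 = ((t ^ 2 - 4 * n : ℤ) : ZMod l) := hx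
    push_cast at hx
    have h3 : (2 : ZMod l)⁻¹ * 2 = 1 := inv_mul_cancel₀ h2
    refine ⟨⟨2⁻¹ * (x + t), ?_⟩, Subtype.ext ?_⟩
    · have h4 : (2 : ZMod l)^2 ≠ 0 := pow_ne_zero _ h2
      apply mul_left_cancel₀ h4
      linear_combination hx + ((2 * 2⁻¹ + 1) * (x + t) ^ 2 - 2 * t * (x + t)) * h3
    · show 2 * (2⁻¹ * (x + t)) - (t : ZMod l) = x
      linear_combination (x + t) * h3

lemma E_psi3 (p : ℕ) [Fact p.Prime] (h : p % 4 = 3) (l : ℕ) [Fact l.Prime] :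
    (Nat.card {c : ZMod l // c ^ 2 - ((1 : ℤ) : ZMod l) * c + (((p + 1) / 4 : ℕ) : ℤ) = 0} : ℤ) = 1 + legendreSym p l := by
  have hp2 : p ≠ 2 := by omega
  by_cases hl : l = 2
  · subst hl
    rw [show ((2 : ℕ) : ℤ) = 2 from rfl, legendreSym.at_two hp2, ZMod.χ₈_nat_eq_if_mod_eight]
    have h2 := E_two1
    rw [Int.cast_natCast, h2]
    have h3 : (((p + 1) / 4 : ℕ) : ZMod 2) = 0 ↔ p % 8 = 7 := by
      rw [ZMod.natCast_eq_zero_iff]; omega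
    by_cases h7 : p % 8 = 7
    · rw [if_pos (h3.2 h7), if_neg (by omega), if_pos (Or.inr h7)]; norm_num
    · rw [if_neg (mt h3.1 h7), if_neg (by omega), if_neg (by omega)]; norm_num
  · rw [E_roots l hl]
    have e : (1 : ℤ) ^ 2 - 4 * (((p + 1) / 4 : ℕ) : ℤ) = -1 * p := by omega
    rw [e, legendreSym.mul, legendreSym.at_neg_one hl]
    congr 1
    have hl2 : l % 2 = 1 := (Nat.Prime.mod_two_eq_one_iff_ne_two Fact.out).2 hl
    rcases (by omega : l % 4 = 1 ∨ l % 4 = 3) with h4 | h4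
    · rw [ZMod.χ₄_nat_one_mod_four h4, legendreSym.quadratic_reciprocity_one_mod_four h4 hp2, one_mul]
    · rw [ZMod.χ₄_nat_three_mod_four h4, legendreSym.quadratic_reciprocity_three_mod_four h h4]; ring

lemma E_psi1 (p : ℕ) [Fact p.Prime] (h : p % 4 = 1) (l : ℕ) [Fact l.Prime] :
    (Nat.card {c : ZMod l // c ^ 2 - ((0 : ℤ) : ZMod l) * c + ((p : ℕ) : ℤ) = 0} : ℤ) = 1 + ZMod.χ₄ l * legendreSym p l := by
  have hp2 : p ≠ 2 := by omega
  by_cases hl : l = 2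
  · subst hl
    have h2 := E_two0
    rw [h2]
    have : ZMod.χ₄ ((2 : ℕ) : ZMod 4) = 0 := by decide
    rw [this]; ring
  · rw [E_roots l hl]
    have e : (0 : ℤ) ^ 2 - 4 * (p : ℤ) = -1 * p * 2 ^ 2 := by ring
    have hl2 : ((2 : ℤ) : ZMod l) ≠ 0 := by
      intro h
      have : ((2 : ℕ) : ZMod l) = 0 := by exact_mod_cast h
      rw [ZMod.natCast_eq_zero_iff] at this
      exact hl ((Nat.prime_dvd_prime_iff_eq Fact.out Nat.prime_two).1 this)
    rw [e, legendreSym.mul, legendreSym.sq_one' l hl2, legendreSym.mul, legendreSym.at_neg_one hl,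
      legendreSym.quadratic_reciprocity_one_mod_four h hl]
    ring

lemma E_sum (R : Type*) [CommRing R] [IsDedekindDomain R] [Module.Free ℤ R] [Module.Finite ℤ R] [CharZero R]
    (hr : Module.finrank ℤ R = 2) (ψ : ℕ → ℤ) (h0 : ψ 0 = 0) (h1 : ψ 1 = 1)
    (hm : ∀ m n, ψ (m * n) = ψ m * ψ n) (hψ : ∀ l : ℕ, l.Prime → (EA R l : ℤ) = 1 + ψ l)
    {n : ℕ} (hn : n ≠ 0) : (EA R n : ℤ) = ∑ d ∈ n.divisors, ψ d := by
  let F : ArithmeticFunction ℤ := ⟨fun n => if n = 0 then 0 else (EA R n : ℤ), by simp⟩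
  let G : ArithmeticFunction ℤ := ⟨ψ, h0⟩
  have hF : F.IsMultiplicative := by
    refine ArithmeticFunction.IsMultiplicative.iff_ne_zero.2 ⟨?_, ?_⟩
    · show (if 1 = 0 then 0 else (EA R 1 : ℤ)) = 1
      rw [EA_one]; simp
    · intro m n hm hn hc
      show (if m * n = 0 then 0 else (EA R (m * n) : ℤ)) = (if m = 0 then 0 else (EA R m : ℤ)) *
        (if n = 0 then 0 else (EA R n : ℤ))
      rw [if_neg (mul_ne_zero hm hn), if_neg hm, if_neg hn, EA_mul R hc]
      push_cast; rfl
  have hG : G.IsMultiplicative := ⟨h1, fun {m n} _ => hm m n⟩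
  have hZ : ((ArithmeticFunction.zeta : ArithmeticFunction ℤ) * G).IsMultiplicative :=
    ArithmeticFunction.isMultiplicative_zeta.natCast.mul hG
  have hpow : ∀ l i : ℕ, ψ (l ^ i) = ψ l ^ i := by
    intro l i
    induction i with
    | zero => simpa using h1
    | succ i ih => rw [pow_succ, hm, ih, pow_succ]
  have key : F = (ArithmeticFunction.zeta : ArithmeticFunction ℤ) * G := by
    rw [ArithmeticFunction.IsMultiplicative.eq_iff_eq_on_prime_powers _ hF _ hZ]
    intro l i hl
    rw [ArithmeticFunction.coe_zeta_mul_apply, Nat.sum_divisors_prime_pow hl]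
    show (if l ^ i = 0 then 0 else (EA R (l ^ i) : ℤ)) = ∑ x ∈ Finset.range (i + 1), ψ (l ^ x)
    rw [if_neg (pow_ne_zero _ hl.ne_zero), E_pp R hr hl (ψ l) (hψ l hl)]
    simp only [hpow]
  have := congrArg (fun f : ArithmeticFunction ℤ => f n) key
  simp only [ArithmeticFunction.coe_zeta_mul_apply] at this
  rw [← show F n = EA R n from if_neg hn, this]
  rfl

open Filter Topology in
lemma E_lim (K : Type) [Field K] [NumberField K]
    (hr : Module.finrank ℤ (NumberField.RingOfIntegers K) = 2) (ψ : ℕ → ℤ) (h0 : ψ 0 = 0) (h1 : ψ 1 = 1)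
    (hm : ∀ m n, ψ (m * n) = ψ m * ψ n) (hb : ∀ n, |ψ n| ≤ 1)
    (hψ : ∀ l : ℕ, l.Prime → (EA (NumberField.RingOfIntegers K) l : ℤ) = 1 + ψ l) (L : ℝ)
    (hL : Tendsto (fun s : ℝ => LSeries (fun n => (ψ n : ℂ)) s) (𝓝[>] 1) (𝓝 (L : ℂ))) :
    NumberField.dedekindZeta_residue K = L := by
  have hfac : ∀ s : ℝ, 1 < s → NumberField.dedekindZeta K s = riemannZeta s * LSeries (fun n => (ψ n : ℂ)) s := by
    intro s hs
    have hs' : 1 < (s : ℂ).re := by simpa using hs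
    have hsum : LSeriesSummable (fun n => (ψ n : ℂ)) s := by
      refine LSeriesSummable_of_bounded_of_one_lt_re (m := 1) (fun n _ => ?_) hs'
      rw [Complex.norm_intCast]; exact_mod_cast hb n
    have hone : LSeriesSummable (1 : ℕ → ℂ) s := by
      refine LSeriesSummable_of_bounded_of_one_lt_re (m := 1) (fun n _ => ?_) hs'
      simp
    rw [← LSeries_one_eq_riemannZeta hs', ← LSeries_convolution' hone hsum]
    unfold NumberField.dedekindZeta
    refine LSeries_congr (fun {n} hn => ?_) _
    rw [LSeries.convolution_def]
    have := E_sum _ hr ψ h0 h1 hm hψ hn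
    unfold EA at this
    have h2 := congrArg (Int.cast : ℤ → ℂ) this
    push_cast at h2
    rw [h2]
    simp only [Pi.one_apply, one_mul]
    exact (Nat.sum_divisorsAntidiagonal' (fun _ y => (ψ y : ℂ)) (n := n)).symm
  have hz : Tendsto (fun s : ℝ => ((s : ℂ) - 1) * riemannZeta s) (𝓝[>] 1) (𝓝 1) := by
    refine riemannZeta_residue_one.comp ?_
    refine tendsto_nhdsWithin_iff.2 ⟨?_, ?_⟩
    · exact tendsto_nhdsWithin_of_tendsto_nhds (by simpa using Complex.continuous_ofReal.tendsto 1)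
    · filter_upwards [self_mem_nhdsWithin] with s hs
      have hs : 1 < s := hs
      simp only [Set.mem_compl_iff, Set.mem_singleton_iff]
      exact_mod_cast hs.ne'
  have h3 := hz.mul hL
  rw [one_mul] at h3
  have h4 := NumberField.tendsto_sub_one_mul_dedekindZeta_nhdsGT K
  have h5 := tendsto_nhds_unique (h4.congr' (by
    filter_upwards [self_mem_nhdsWithin] with s hs
    rw [hfac s hs, ← mul_assoc])) h3
  exact_mod_cast h5

section FF

variable {A S : Type*} [CommRing A] [CommRing S] [Algebra A S]

lemma F_basis [LinearOrder A] [IsStrictOrderedRing A] (hinj : Function.Injective (algebraMap A S))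
    (w : S) (t n : A) (hw : w ^ 2 = algebraMap A S t * w - algebraMap A S n) (hd : t ^ 2 - 4 * n < 0)
    (hs : ∀ z : S, ∃ x y : A, z = algebraMap A S x + algebraMap A S y * w) :
    ∃ b : Module.Basis (Fin 2) A S, b 0 = 1 ∧ b 1 = w := by
  have hli : LinearIndependent A ![(1 : S), w] := by
    rw [LinearIndependent.pair_iff]
    intro x y h
    rw [Algebra.smul_def, Algebra.smul_def, mul_one] at h
    have e : algebraMap A S ((2 * x + t * y) ^ 2 + (4 * n - t ^ 2) * y ^ 2) = algebraMap A S 0 := by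
      simp only [map_add, map_sub, map_mul, map_pow, map_zero, map_ofNat]
      linear_combination (4 * (algebraMap A S x + algebraMap A S t * algebraMap A S y - algebraMap A S y * w)) * h +
        4 * (algebraMap A S y) ^ 2 * hw
    have e := hinj e
    have h1 : 0 ≤ (2 * x + t * y) ^ 2 := sq_nonneg _
    have h2 : 0 ≤ y ^ 2 := sq_nonneg _
    have h3 : y ^ 2 = 0 := by nlinarith
    have hy : y = 0 := pow_eq_zero_iff (two_ne_zero) |>.1 h3
    refine ⟨?_, hy⟩
    subst hy
    apply hinj
    simpa using h
  have hsp : ⊤ ≤ Submodule.span A (Set.range ![(1 : S), w]) := by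
    intro z _
    obtain ⟨x, y, rfl⟩ := hs z
    rw [Matrix.range_cons_cons_empty, Submodule.mem_span_pair]
    exact ⟨x, y, by rw [Algebra.smul_def, Algebra.smul_def, mul_one]⟩
  exact ⟨Module.Basis.mk hli hsp, by simp, by simp⟩

lemma F_tn (b : Module.Basis (Fin 2) A S) (hb0 : b 0 = 1) (t n : A)
    (hw : b 1 ^ 2 = algebraMap A S t * b 1 - algebraMap A S n) (x y : A) :
    Algebra.trace A S (algebraMap A S x + algebraMap A S y * b 1) = 2 * x + t * y ∧
    Algebra.norm A (algebraMap A S x + algebraMap A S y * b 1) = x ^ 2 + t * x * y + n * y ^ 2 := by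
  set z := algebraMap A S x + algebraMap A S y * b 1 with hz
  have e0 : z * b 0 = x • b 0 + y • b 1 := by
    rw [hz, hb0, Algebra.smul_def, Algebra.smul_def]; ring
  have e1 : z * b 1 = (-n * y) • b 0 + (x + t * y) • b 1 := by
    rw [hz, hb0, Algebra.smul_def, Algebra.smul_def]
    simp only [map_add, map_mul, map_neg]
    linear_combination algebraMap A S y * hw
  have m00 : Algebra.leftMulMatrix b z 0 0 = x := by
    rw [Algebra.leftMulMatrix_eq_repr_mul, e0, map_add, map_smul, map_smul, b.repr_self, b.repr_self]; simp
  have m10 : Algebra.leftMulMatrix b z 1 0 = y := by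
    rw [Algebra.leftMulMatrix_eq_repr_mul, e0, map_add, map_smul, map_smul, b.repr_self, b.repr_self]; simp
  have m01 : Algebra.leftMulMatrix b z 0 1 = -n * y := by
    rw [Algebra.leftMulMatrix_eq_repr_mul, e1, map_add, map_smul, map_smul, b.repr_self, b.repr_self]; simp
  have m11 : Algebra.leftMulMatrix b z 1 1 = x + t * y := by
    rw [Algebra.leftMulMatrix_eq_repr_mul, e1, map_add, map_smul, map_smul, b.repr_self, b.repr_self]; simp
  constructor
  · rw [Algebra.trace_eq_matrix_trace b, Matrix.trace_fin_two, m00, m11]; ring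
  · rw [Algebra.norm_eq_matrix_det b, Matrix.det_fin_two, m00, m11, m01, m10]; ring

lemma F_discr (b : Module.Basis (Fin 2) A S) (hb0 : b 0 = 1) (t n : A)
    (hw : b 1 ^ 2 = algebraMap A S t * b 1 - algebraMap A S n) :
    Algebra.discr A b = t ^ 2 - 4 * n := by
  have h := fun x y => (F_tn b hb0 t n hw x y).1
  rw [Algebra.discr_def, Matrix.det_fin_two]
  simp only [Algebra.traceMatrix_apply, Algebra.traceForm_apply, hb0, one_mul, mul_one]
  have h1 := h 1 0
  have h2 := h 0 1
  have h3 := h (-n) t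
  have e : algebraMap A S (-n) + algebraMap A S t * b 1 = b 1 * b 1 := by
    rw [map_neg]; linear_combination -hw
  rw [e] at h3
  simp only [map_one, map_zero, zero_mul, add_zero, zero_add, one_mul] at h1 h2
  rw [h1, h2, h3]; ring

end FF

lemma F_rep (p : ℕ) (K : Type) [Field K] [NumberField K] (α : K) (hα : α ^ 2 = -(p : K))
    (hgen : IntermediateField.adjoin ℚ {α} = ⊤) (z : K) :
    ∃ x y : ℚ, z = algebraMap ℚ K x + algebraMap ℚ K y * α := by
  have h1 : IsIntegral ℚ α := Algebra.IsIntegral.isIntegral α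
  have h2 : Algebra.adjoin ℚ {α} = ⊤ := by
    rw [← IntermediateField.adjoin_simple_toSubalgebra_of_isAlgebraic h1.isAlgebraic, hgen]
    simp
  have hz : z ∈ Algebra.adjoin ℚ {α} := by rw [h2]; trivial
  induction hz using Algebra.adjoin_induction with
  | mem x hx =>
    rw [Set.mem_singleton_iff.1 hx]
    exact ⟨0, 1, by simp⟩
  | algebraMap r => exact ⟨r, 0, by simp⟩
  | add x y _ _ hx hy =>
    obtain ⟨a, b, rfl⟩ := hx
    obtain ⟨c, d, rfl⟩ := hy
    exact ⟨a + c, b + d, by simp only [map_add]; ring⟩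
  | mul x y _ _ hx hy =>
    obtain ⟨a, b, rfl⟩ := hx
    obtain ⟨c, d, rfl⟩ := hy
    refine ⟨a * c - p * (b * d), a * d + b * c, ?_⟩
    simp only [map_add, map_sub, map_mul, map_natCast]
    linear_combination (algebraMap ℚ K b * algebraMap ℚ K d) * hα

lemma F_int (p : ℕ) [Fact p.Prime] (K : Type) [Field K] [NumberField K] (α : K) (hα : α ^ 2 = -(p : K))
    (hgen : IntermediateField.adjoin ℚ {α} = ⊤) (z : NumberField.RingOfIntegers K) :
    ∃ a b : ℤ, 2 * (z : K) = a + b * α ∧ (4 : ℤ) ∣ a ^ 2 + p * b ^ 2 := by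
  have hpp : p.Prime := Fact.out
  have hp0 : (0 : ℚ) < p := by exact_mod_cast hpp.pos
  obtain ⟨B, hB0, hB1⟩ := F_basis (A := ℚ) (S := K) (algebraMap ℚ K).injective α 0 p
    (by rw [hα]; simp) (by linarith) (F_rep p K α hα hgen)
  obtain ⟨x, y, hxy⟩ := F_rep p K α hα hgen z
  obtain ⟨ht, hn⟩ := F_tn B hB0 0 (p : ℚ) (by rw [hB1, hα]; simp) x y
  rw [hB1, ← hxy] at ht hn
  have hzi : IsIntegral ℤ (z : K) := z.2
  obtain ⟨a, ha⟩ := IsIntegrallyClosed.isIntegral_iff.1 (Algebra.isIntegral_trace (L := ℚ) hzi)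
  obtain ⟨c, hc⟩ := IsIntegrallyClosed.isIntegral_iff.1 (Algebra.isIntegral_norm ℚ hzi)
  rw [ht] at ha
  rw [hn] at hc
  simp at ha hc
  -- `ha : a = 2 * x`, `hc : c = x ^ 2 + p * y ^ 2`
  have h1 : (p : ℚ) * (2 * y) ^ 2 = ((4 * c - a ^ 2 : ℤ) : ℚ) := by
    push_cast; rw [ha, hc]; ring
  have h2 : ((p : ℚ) * (2 * y)) ^ 2 = ((p * (4 * c - a ^ 2) : ℤ) : ℚ) := by
    push_cast at h1 ⊢; rw [← h1]; ring
  have h3 : IsIntegral ℤ ((p : ℚ) * (2 * y)) := by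
    apply IsIntegral.of_pow (n := 2) (by norm_num)
    rw [h2]
    exact isIntegral_algebraMap (R := ℤ) (A := ℚ) (x := (p * (4 * c - a ^ 2) : ℤ))
  obtain ⟨m, hm⟩ := IsIntegrallyClosed.isIntegral_iff.1 h3
  simp at hm
  rw [← hm] at h2
  have h4 : m ^ 2 = p * (4 * c - a ^ 2) := by exact_mod_cast h2
  have h5 : (p : ℤ) ∣ m := (Nat.prime_iff_prime_int.1 hpp).dvd_of_dvd_pow (Dvd.intro _ h4.symm)
  obtain ⟨b, rfl⟩ := h5
  have h6 : (b : ℚ) = 2 * y := by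
    push_cast at hm
    exact mul_left_cancel₀ hp0.ne' hm
  refine ⟨a, b, ?_, c, ?_⟩
  · rw [hxy]
    have e1 : (a : K) = algebraMap ℚ K (a : ℚ) := by simp
    have e2 : (b : K) = algebraMap ℚ K (b : ℚ) := by simp
    rw [e1, e2, ha, h6]
    simp only [map_mul, map_ofNat]; ring
  · have : ((a ^ 2 + p * b ^ 2 : ℤ) : ℚ) = ((4 * c : ℤ) : ℚ) := by
      push_cast; rw [ha, hc, h6]; ring
    exact_mod_cast this

open NumberField in
lemma F_basis1 (p : ℕ) [Fact p.Prime] (h : p % 4 = 1) (K : Type) [Field K] [NumberField K] (α : K) (hα : α ^ 2 = -(p : K))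
    (hgen : IntermediateField.adjoin ℚ {α} = ⊤) :
    ∃ b : Module.Basis (Fin 2) ℤ (𝓞 K), b 0 = 1 ∧ b 1 ^ 2 = ((0 : ℤ) : 𝓞 K) * b 1 - ((p : ℤ) : 𝓞 K) := by
  have hint : IsIntegral ℤ α := by
    apply IsIntegral.of_pow (n := 2) (by norm_num)
    rw [hα]
    have := isIntegral_algebraMap (R := ℤ) (A := K) (x := -(p : ℤ))
    simpa using this
  obtain ⟨w, hwα⟩ : ∃ w : 𝓞 K, algebraMap (𝓞 K) K w = α := ⟨⟨α, hint⟩, rfl⟩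
  have hw : w ^ 2 = ((0 : ℤ) : 𝓞 K) * w - ((p : ℤ) : 𝓞 K) := by
    apply RingOfIntegers.ext
    simp only [map_pow, map_sub, map_mul, map_intCast]
    rw [hwα, hα]; simp
  obtain ⟨b, hb0, hb1⟩ := F_basis (A := ℤ) (S := 𝓞 K) (by simpa using Int.cast_injective) w 0 p
    (by simpa using hw) (by have := (Fact.out : p.Prime).pos; push_cast; omega) (by
      intro z
      obtain ⟨a, b, hab, h4⟩ := F_int p K α hα hgen z
      have h2 : Even a ∧ Even b := by
        obtain ⟨c, hc⟩ := h4
        obtain ⟨q, hq⟩ : ∃ q : ℤ, (p : ℤ) = 4 * q + 1 := ⟨p / 4, by omega⟩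
        rw [hq] at hc
        rcases Int.even_or_odd' a with ⟨k, rfl | rfl⟩ <;> rcases Int.even_or_odd' b with ⟨l, rfl | rfl⟩
        · exact ⟨even_two_mul _, even_two_mul _⟩
        all_goals
          exfalso
          ring_nf at hc
          omega
      obtain ⟨⟨c, rfl⟩, ⟨d, rfl⟩⟩ := h2
      refine ⟨c, d, RingOfIntegers.ext ?_⟩
      simp only [map_add, map_mul, algebraMap_int_eq, eq_intCast, map_intCast]
      rw [hwα]
      push_cast at hab
      linear_combination hab / 2)
  refine ⟨b, hb0, ?_⟩
  rw [hb1, hw]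

open NumberField in
lemma F_basis3 (p : ℕ) [Fact p.Prime] (h : p % 4 = 3) (K : Type) [Field K] [NumberField K] (α : K) (hα : α ^ 2 = -(p : K))
    (hgen : IntermediateField.adjoin ℚ {α} = ⊤) :
    ∃ b : Module.Basis (Fin 2) ℤ (𝓞 K), b 0 = 1 ∧ b 1 ^ 2 = ((1 : ℤ) : 𝓞 K) * b 1 - ((((p + 1) / 4 : ℕ) : ℤ) : 𝓞 K) := by
  have hq : 4 * ((p + 1) / 4) = p + 1 := by omega
  set q := (p + 1) / 4 with hqdef
  have hqK : 4 * (q : K) = p + 1 := by exact_mod_cast congrArg (Nat.cast : ℕ → K) hq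
  have hω : ((1 + α) / 2) ^ 2 = (1 + α) / 2 - (q : K) := by
    linear_combination (1 / 4) * hα + (1 / 4) * hqK
  have hint : IsIntegral ℤ ((1 + α) / 2) := by
    refine ⟨Polynomial.X ^ 2 - Polynomial.X + Polynomial.C (q : ℤ), ?_, ?_⟩
    · monicity!
    · simp [hω]
  obtain ⟨w, hwα⟩ : ∃ w : 𝓞 K, algebraMap (𝓞 K) K w = (1 + α) / 2 := ⟨⟨(1 + α) / 2, hint⟩, rfl⟩
  have hw : w ^ 2 = ((1 : ℤ) : 𝓞 K) * w - ((q : ℤ) : 𝓞 K) := by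
    apply RingOfIntegers.ext
    simp only [map_pow, map_sub, map_mul, map_intCast]
    rw [hwα, hω]; simp
  obtain ⟨b, hb0, hb1⟩ := F_basis (A := ℤ) (S := 𝓞 K) (by simpa using Int.cast_injective) w 1 q
    (by simpa using hw) (by omega) (by
      intro z
      obtain ⟨a, b, hab, h4⟩ := F_int p K α hα hgen z
      have h2 : Even (a - b) := by
        have h2 : Even (a ^ 2 + p * b ^ 2) := by
          obtain ⟨c, hc⟩ := h4
          exact ⟨2 * c, by rw [hc]; ring⟩
        have hp : ¬ Even (p : ℤ) := by rw [Int.even_iff]; omega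
        simp only [Int.even_add, Int.even_mul, Int.even_pow, Int.even_sub, hp] at h2 ⊢
        simpa using h2
      obtain ⟨c, hc⟩ := h2
      have ha : a = b + 2 * c := by linarith
      subst ha
      refine ⟨c, b, RingOfIntegers.ext ?_⟩
      simp only [map_add, map_mul, algebraMap_int_eq, eq_intCast, map_intCast]
      rw [hwα]
      push_cast at hab
      linear_combination hab / 2)
  refine ⟨b, hb0, ?_⟩
  rw [hb1, hw]

open NumberField in
lemma F_residue (K : Type) [Field K] [NumberField K] (b : Module.Basis (Fin 2) ℤ (𝓞 K)) (hb0 : b 0 = 1)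
    (t n : ℤ) (hb : b 1 ^ 2 = (t : 𝓞 K) * b 1 - (n : 𝓞 K)) (hd : 4 < 4 * n - t ^ 2) :
    dedekindZeta_residue K = Real.pi * classNumber K / Real.sqrt (4 * n - t ^ 2 : ℤ) := by
  have hbA : b 1 ^ 2 = algebraMap ℤ (𝓞 K) t * b 1 - algebraMap ℤ (𝓞 K) n := by simpa using hb
  have hfin : Module.finrank ℤ (𝓞 K) = 2 := by rw [Module.finrank_eq_card_basis b]; simp
  have hfinK : Module.finrank ℚ K = 2 := by rw [← RingOfIntegers.rank, hfin]
  have hdisc : discr K = t ^ 2 - 4 * n := by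
    rw [← discr_eq_discr K b, F_discr b hb0 t n hbA]
  have htot : IsTotallyComplex K := by
    refine ⟨fun v => ?_⟩
    rw [← InfinitePlace.not_isReal_iff_isComplex]
    intro hv
    obtain ⟨φ, hφ⟩ : ∃ φ : K →+* ℝ, True := ⟨InfinitePlace.embedding_of_isReal hv, trivial⟩
    have e := congrArg (fun z : 𝓞 K => φ (z : K)) hb
    simp at e
    have hd' : (4 : ℝ) < 4 * n - t ^ 2 := by exact_mod_cast hd
    nlinarith [sq_nonneg (2 * φ (b 1 : K) - t)]
  have hr : InfinitePlace.nrRealPlaces K = 0 := IsTotallyComplex.nrRealPlaces_eq_zero K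
  have hc : InfinitePlace.nrComplexPlaces K = 1 := by
    have := InfinitePlace.card_add_two_mul_card_eq_rank K
    omega
  have hunit : ∀ u : (𝓞 K)ˣ, u = 1 ∨ u = -1 := by
    intro u
    have h1 : IsUnit (Algebra.norm ℤ (u : 𝓞 K)) := u.isUnit.map _
    have h2 := E_repr b hb0 (u : 𝓞 K)
    obtain ⟨_, hn⟩ := F_tn b hb0 t n hbA (b.repr (u : 𝓞 K) 0) (b.repr (u : 𝓞 K) 1)
    rw [eq_intCast, eq_intCast, ← h2] at hn
    set x := b.repr (u : 𝓞 K) 0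
    set y := b.repr (u : 𝓞 K) 1
    rw [hn, Int.isUnit_iff] at h1
    have hy : y = 0 := by
      by_contra hy
      have : 1 ≤ y ^ 2 := Int.one_le_abs hy |> fun h => by nlinarith [sq_abs y, abs_nonneg y]
      have h4 : (2 * x + t * y) ^ 2 + (4 * n - t ^ 2) * y ^ 2 = 4 * (x ^ 2 + t * x * y + n * y ^ 2) := by ring
      rcases h1 with h1 | h1 <;> rw [h1] at h4 <;> nlinarith [sq_nonneg (2 * x + t * y)]
    rw [hy] at h1 h2
    have hx : x = 1 ∨ x = -1 := by
      have hx2 : x ^ 2 = 1 := by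
        rcases h1 with h1 | h1
        · linarith
        · nlinarith [sq_nonneg x]
      exact mul_self_eq_one_iff.1 (by linarith [pow_two x])
    rcases hx with hx | hx
    · left; apply Units.ext; rw [h2, hx]; simp
    · right; apply Units.ext; rw [h2, hx]; simp
  have htors : Units.torsionOrder K = 2 := by
    have hle : Units.torsionOrder K ≤ 2 := by
      unfold Units.torsionOrder
      have : Function.Surjective (fun i : Fin 2 => if i = 0 then (1 : Units.torsion K) else ⟨-1, by
          exact (isOfFinOrder_iff_pow_eq_one).2 ⟨2, by norm_num, by simp⟩⟩) := by
        rintro ⟨u, hu⟩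
        rcases hunit u with rfl | rfl
        · exact ⟨0, rfl⟩
        · exact ⟨1, rfl⟩
      have := Nat.card_le_card_of_surjective _ this
      simpa using this
    have := Units.torsionOrder_pos K
    have := Units.even_torsionOrder K
    rcases this with ⟨k, hk⟩
    omega
  have hrank : Units.rank K = 0 := by
    have : Fintype.card (InfinitePlace K) = 1 := by
      rw [InfinitePlace.card_eq_nrRealPlaces_add_nrComplexPlaces, hr, hc]
    unfold Units.rank
    rw [this]
  have hreg : Units.regulator K = 1 := by
    classical
    have : IsEmpty (Fin (Units.rank K)) := by rw [hrank]; infer_instance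
    rw [Units.regulator_eq_det']
    have h2 := (Units.equivFinRank K).symm.isEmpty
    rw [Matrix.det_isEmpty, abs_one]
  rw [dedekindZeta_residue_def, hr, hc, hreg, htors, hdisc]
  have e : |t ^ 2 - 4 * n| = 4 * n - t ^ 2 := by
    rw [abs_of_neg (by linarith)]; ring
  rw [← Int.cast_abs, e]
  push_cast
  field_simp

lemma G_abs (p : ℕ) [Fact p.Prime] (a : ℤ) : |legendreSym p a| ≤ 1 := by
  by_cases h : ((a : ℤ) : ZMod p) = 0
  · rw [(legendreSym.eq_zero_iff p a).2 h]; simp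
  · rcases legendreSym.eq_one_or_neg_one p h with h | h <;> rw [h] <;> simp

open NumberField in
lemma G_three (p : ℕ) [Fact p.Prime] (h : p % 4 = 3) (h3 : p ≠ 3) (K : Type) [Field K] [NumberField K] (α : K)
    (hα : α ^ 2 = -(p : K)) (hgen : IntermediateField.adjoin ℚ {α} = ⊤) :
    hpStar p = (classNumber K : ℚ) := by
  have hp0 : 0 < p := (Fact.out : p.Prime).pos
  obtain ⟨b, hb0, hb1⟩ := F_basis3 p h K α hα hgen
  have hfin : Module.finrank ℤ (𝓞 K) = 2 := by rw [Module.finrank_eq_card_basis b]; simp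
  have e0 : (4 * (((p + 1) / 4 : ℕ) : ℤ) - 1 ^ 2) = (p : ℤ) := by omega
  have e1 := F_residue K b hb0 1 _ hb1 (by rw [e0]; omega)
  rw [e0] at e1
  have e2 := E_lim K hfin (fun n => legendreSym p n) (by simp) (by simp)
    (fun m n => by push_cast; exact legendreSym.mul p m n) (fun n => G_abs p n)
    (fun l hl => by
      have : Fact l.Prime := ⟨hl⟩
      rw [E_count b 1 _ hb0 hb1]
      exact E_psi3 p h l) _ (D_three p h)
  rw [e1] at e2
  have hs : 0 < Real.sqrt p := Real.sqrt_pos.2 (by exact_mod_cast hp0)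
  have hpi := Real.pi_pos
  have : ((hpStar p : ℚ) : ℝ) = ((classNumber K : ℚ) : ℝ) := by
    push_cast at e2 ⊢
    field_simp at e2
    exact e2.symm
  exact_mod_cast this

open NumberField in
lemma G_one (p : ℕ) [Fact p.Prime] (h : p % 4 = 1) (K : Type) [Field K] [NumberField K] (α : K)
    (hα : α ^ 2 = -(p : K)) (hgen : IntermediateField.adjoin ℚ {α} = ⊤) :
    AX p (-1 / 4) = (classNumber K : ℚ) / 2 := by
  have hp1 : 1 < p := (Fact.out : p.Prime).one_lt
  have hp0 : 0 < p := by omega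
  obtain ⟨b, hb0, hb1⟩ := F_basis1 p h K α hα hgen
  have hfin : Module.finrank ℤ (𝓞 K) = 2 := by rw [Module.finrank_eq_card_basis b]; simp
  have e0 : (4 * (p : ℤ) - 0 ^ 2) = 4 * (p : ℤ) := by ring
  have e1 := F_residue K b hb0 0 _ hb1 (by rw [e0]; omega)
  rw [e0] at e1
  have e2 := E_lim K hfin (fun n => ZMod.χ₄ n * legendreSym p n) (by simp) (by simp)
    (fun m n => by push_cast; rw [map_mul, legendreSym.mul]; ring)
    (fun n => by
      rw [abs_mul]
      have h1 := G_abs p n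
      have h2 : |ZMod.χ₄ (n : ZMod 4)| ≤ 1 := by
        generalize (n : ZMod 4) = c
        revert c; decide
      exact mul_le_one₀ h2 (abs_nonneg _) h1)
    (fun l hl => by
      have : Fact l.Prime := ⟨hl⟩
      rw [E_count b 0 _ hb0 hb1]
      exact E_psi1 p h l) _ (by simpa only [Int.cast_mul] using D_one p h)
  rw [e1] at e2
  have hs : 0 < Real.sqrt p := Real.sqrt_pos.2 (by exact_mod_cast hp0)
  have hs4 : Real.sqrt ((4 * (p : ℤ) : ℤ) : ℝ) = 2 * Real.sqrt p := by
    push_cast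
    rw [Real.sqrt_mul (by norm_num), show (4 : ℝ) = 2 ^ 2 by norm_num, Real.sqrt_sq (by norm_num)]
  rw [hs4] at e2
  have hpi := Real.pi_pos
  have : ((AX p (-1 / 4) : ℚ) : ℝ) = ((classNumber K / 2 : ℚ) : ℝ) := by
    push_cast at e2 ⊢
    field_simp at e2
    linarith
  exact_mod_cast this

lemma G_hp3 (p : ℕ) [Fact p.Prime] (h : p = 3) : hpStar p = 1 / 3 := by
  subst h
  have h1 : legendreSym 3 1 = 1 := by simp
  have h2 : legendreSym 3 2 = -1 := by
    rw [legendreSym.at_two (by norm_num)]; decide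
  unfold hpStar
  simp only [Finset.sum_range_succ, Finset.sum_range_zero]
  push_cast
  rw [h1, h2]
  norm_num

lemma G_sum (p : ℕ) [Fact p.Prime] (hodd : Odd p) (r : ℕ) (c : ℚ) (hc : AC p = c / 2) :
    ∑ x ∈ Finset.Icc 1 (2 * p ^ r), Int.fract (-(x : ℚ) ^ 2 / (4 * (p : ℚ) ^ r)) =
        (p : ℚ) ^ r - Int.fract ((p : ℚ) ^ r / 4) * (p : ℚ) ^ (r / 2) +
          (((p : ℚ) ^ ((r + 1) / 2) - 1) / (2 * ((p : ℚ) - 1))) * c := by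
  rw [A_total p hodd r, AW p hodd r, hc]
  have h1 : (p : ℚ) - 1 ≠ 0 := by
    have : (1 : ℚ) < p := by exact_mod_cast (Fact.out : p.Prime).one_lt
    linarith
  field_simp

/-- For `p` an odd prime, `r ≥ 1` and `h_p` the class number of the
imaginary quadratic field `ℚ(√-p)` (a number field `K` generated over `ℚ` by a square
root `α` of `-p`), writing `Tr L = ∑_{x=1}^{2p^r} {-x²/(4p^r)}`, we have
`Tr L = p^r - {p^r/4}·p^⌊r/2⌋ + ((p^⌊(r+1)/2⌋-1)/(2(p-1)))·c` with `c = h_p` if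
`p ≡ 1 (mod 4)`, `c = 4h_p^* + 1` if `p ≡ 3 (mod 8)`, and `c = 2h_p + 1` if
`p ≡ 7 (mod 8)`; moreover `h_p^* = h_p` whenever `p ≡ 3 (mod 8)` and `p ≠ 3`, while
`h_3^* = 1/3`. -/
theorem trace_exponents_weil_classNumber (p : ℕ) [Fact p.Prime] (hodd : Odd p)
    (r : ℕ) (hr : 1 ≤ r)
    (K : Type) [Field K] [NumberField K] (α : K) (hα : α ^ 2 = -(p : K))
    (hgen : IntermediateField.adjoin ℚ {α} = ⊤) :
    (p % 4 = 1 →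
      ∑ x ∈ Finset.Icc 1 (2 * p ^ r), Int.fract (-(x : ℚ) ^ 2 / (4 * (p : ℚ) ^ r)) =
        (p : ℚ) ^ r - Int.fract ((p : ℚ) ^ r / 4) * (p : ℚ) ^ (r / 2) +
          (((p : ℚ) ^ ((r + 1) / 2) - 1) / (2 * ((p : ℚ) - 1))) *
            (NumberField.classNumber K : ℚ)) ∧
    (p % 8 = 3 →
      ∑ x ∈ Finset.Icc 1 (2 * p ^ r), Int.fract (-(x : ℚ) ^ 2 / (4 * (p : ℚ) ^ r)) =
        (p : ℚ) ^ r - Int.fract ((p : ℚ) ^ r / 4) * (p : ℚ) ^ (r / 2) +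
          (((p : ℚ) ^ ((r + 1) / 2) - 1) / (2 * ((p : ℚ) - 1))) *
            (4 * hpStar p + 1)) ∧
    (p % 8 = 7 →
      ∑ x ∈ Finset.Icc 1 (2 * p ^ r), Int.fract (-(x : ℚ) ^ 2 / (4 * (p : ℚ) ^ r)) =
        (p : ℚ) ^ r - Int.fract ((p : ℚ) ^ r / 4) * (p : ℚ) ^ (r / 2) +
          (((p : ℚ) ^ ((r + 1) / 2) - 1) / (2 * ((p : ℚ) - 1))) *
            (2 * (NumberField.classNumber K : ℚ) + 1)) ∧
    (p % 8 = 3 → p ≠ 3 → hpStar p = (NumberField.classNumber K : ℚ)) ∧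
    (p = 3 → hpStar p = 1 / 3) := by
  refine ⟨fun h => ?_, fun h => ?_, fun h => ?_, fun h h3 => ?_, fun h => G_hp3 p h⟩
  · apply G_sum p hodd
    rw [A_final_one p hodd h, G_one p h K α hα hgen]
  · apply G_sum p hodd
    have h2 : legendreSym p 2 = -1 := by
      rw [legendreSym.at_two (by omega), ZMod.χ₈_nat_eq_if_mod_eight]
      simp [h, show p % 2 = 1 by omega]
    rw [A_final_three p hodd (by omega), h2]
    push_cast; ring
  · apply G_sum p hodd
    have h2 : legendreSym p 2 = 1 := by
      rw [legendreSym.at_two (by omega), ZMod.χ₈_nat_eq_if_mod_eight]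
      simp [h, show p % 2 = 1 by omega]
    rw [A_final_three p hodd (by omega), h2, G_three p (by omega) (by rintro rfl; omega) K α hα hgen]
    push_cast; ring
  · exact G_three p (by omega) h3 K α hα hgen
end

section
/- Let p be an odd prime with p ≥ 5 and r ≥ 1 an integer. Then exp(πi/4) · (1/√(2p^r)) · ∑_{x=0}^{2p^r − 1} exp(2πi · 3x²/(4p^r)) = (p^r | 3), where (p^r | 3) denotes the Legendre symbol of p^r modulo 3 (equal to 1 if p^r ≡ 1 (mod 3) and −1 if p^r ≡ 2 (mod 3)). -/
open Complex Filter Topology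

lemma theta2_tendsto_one {α : Type*} {F : Filter α} (x : ℝ) (τ : α → ℂ)
    (h : Tendsto (fun t => (τ t).im) F atTop) :
    Tendsto (fun t => jacobiTheta₂ (x : ℂ) (τ t)) F (𝓝 1) := by
  have key := tendsto_tsum_of_dominated_convergence (𝓕 := F)
    (f := fun t (n : ℤ) => jacobiTheta₂_term n (x : ℂ) (τ t))
    (g := fun n : ℤ => if n = 0 then (1 : ℂ) else 0)
    (bound := fun n : ℤ => Real.exp (-Real.pi * (1 * (n : ℝ) ^ 2 - 2 * 0 * |(n : ℝ)|)))
    (by simpa using summable_pow_mul_jacobiTheta₂_term_bound 0 one_pos 0) ?_ ?_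
  · simpa [jacobiTheta₂, tsum_ite_eq] using key
  · intro n
    by_cases hn : n = 0
    · subst hn
      simpa [jacobiTheta₂_term] using tendsto_const_nhds
    · simp only [hn, if_false]
      rw [tendsto_zero_iff_norm_tendsto_zero]
      simp only [norm_jacobiTheta₂_term, ofReal_im, mul_zero, sub_zero]
      refine Real.tendsto_exp_atBot.comp ?_
      refine Tendsto.const_mul_atTop_of_neg ?_ h
      have : (0 : ℝ) < (n : ℝ) ^ 2 := by positivity
      nlinarith [Real.pi_pos]
  · filter_upwards [h.eventually_ge_atTop 1] with t ht n
    have := norm_jacobiTheta₂_term_le one_pos (z := (x : ℂ)) (S := 0) (by simp) ht n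
    simpa using this

lemma theta_decomp (a : ℤ) (c : ℕ) (hc : 0 < c) (hac : Even (a * c)) (δ : ℂ) (hδ : 0 < δ.im) :
    jacobiTheta ((a : ℂ) / c + δ) * (-I * (c ^ 2 * δ)) ^ (1 / 2 : ℂ) =
      ∑ r : Fin c, cexp (Real.pi * I * a * ((r : ℕ) : ℂ) ^ 2 / c) *
        jacobiTheta₂ ((((r : ℕ) : ℝ) / c : ℝ) : ℂ) (-1 / (c ^ 2 * δ)) := by
  have : NeZero c := ⟨hc.ne'⟩
  have hc0 : (c : ℂ) ≠ 0 := by exact_mod_cast hc.ne'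
  have hδ0 : δ ≠ 0 := by rintro rfl; simp at hδ
  have him : 0 < ((a : ℂ) / c + δ).im := by
    have : ((a : ℂ) / c).im = 0 := by
      have : ((a : ℂ) / c) = ((a / c : ℝ) : ℂ) := by push_cast; rfl
      rw [this, ofReal_im]
    rw [add_im, this]; simpa using hδ
  have hs := hasSum_jacobiTheta₂_term 0 him
  rw [← jacobiTheta_eq_jacobiTheta₂] at hs
  have hcδ : 0 < ((c : ℂ) ^ 2 * δ).im := by
    have : ((c : ℂ) ^ 2 * δ) = ((c ^ 2 : ℝ) : ℂ) * δ := by push_cast; rfl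
    rw [this, im_ofReal_mul]; positivity
  have hpow : (-I * (c ^ 2 * δ)) ^ (1 / 2 : ℂ) ≠ 0 := by
    rw [Ne, cpow_eq_zero_iff, not_and_or]
    left; simp [hc0, hδ0]
  have hterm : ∀ (r : Fin c) (m : ℤ), jacobiTheta₂_term ((Int.divModEquiv c).symm (m, r)) 0
      ((a : ℂ) / c + δ) = cexp (Real.pi * I * a * ((r : ℕ) : ℂ) ^ 2 / c) *
        (cexp (Real.pi * I * δ * ((r : ℕ) : ℂ) ^ 2) *
        jacobiTheta₂_term m (δ * c * ((r : ℕ) : ℂ)) (c ^ 2 * δ)) := by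
    intro r m
    obtain ⟨k, hk⟩ := hac
    have hk' : (a : ℂ) * c = k + k := by exact_mod_cast hk
    simp only [jacobiTheta₂_term, Int.divModEquiv, Equiv.coe_fn_symm_mk]
    rw [← Complex.exp_add, ← Complex.exp_add, Complex.exp_eq_exp_iff_exists_int]
    refine ⟨k * m ^ 2 + a * m * (r : ℕ), ?_⟩
    push_cast
    have e : (k : ℂ) = a * c / 2 := by rw [hk']; ring
    rw [e]
    field_simp
    ring
  have hinner : ∀ r : Fin c, cexp (Real.pi * I * δ * ((r : ℕ) : ℂ) ^ 2) *
        jacobiTheta₂ (δ * c * ((r : ℕ) : ℂ)) (c ^ 2 * δ) = 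
        1 / (-I * (c ^ 2 * δ)) ^ (1 / 2 : ℂ) *
        jacobiTheta₂ ((((r : ℕ) : ℝ) / c : ℝ) : ℂ) (-1 / (c ^ 2 * δ)) := by
    intro r
    rw [jacobiTheta₂_functional_equation]
    have e1 : δ * c * ((r : ℕ) : ℂ) / (c ^ 2 * δ) = ((((r : ℕ) : ℝ) / c : ℝ) : ℂ) := by
      push_cast; field_simp
    have e2 : -Real.pi * I * (δ * c * ((r : ℕ) : ℂ)) ^ 2 / (c ^ 2 * δ)
      = -(Real.pi * I * δ * ((r : ℕ) : ℂ) ^ 2) := by field_simp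
    rw [e1, e2, Complex.exp_neg]
    have := Complex.exp_ne_zero (Real.pi * I * δ * ((r : ℕ) : ℂ) ^ 2)
    field_simp
  have hs2 := ((Equiv.prodComm (Fin c) ℤ).trans (Int.divModEquiv c).symm).hasSum_iff.mpr hs
  have hs3 := hs2.prod_fiberwise (g := fun r : Fin c =>
    cexp (Real.pi * I * a * ((r : ℕ) : ℂ) ^ 2 / c) * (cexp (Real.pi * I * δ * ((r : ℕ) : ℂ) ^ 2) *
        jacobiTheta₂ (δ * c * ((r : ℕ) : ℂ)) (c ^ 2 * δ))) (by
      intro r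
      have := ((hasSum_jacobiTheta₂_term (δ * c * ((r : ℕ) : ℂ)) hcδ).mul_left
        (cexp (Real.pi * I * δ * ((r : ℕ) : ℂ) ^ 2))).mul_left
        (cexp (Real.pi * I * a * ((r : ℕ) : ℂ) ^ 2 / c))
      refine this.congr_fun ?_ 
      intro m
      exact hterm r m)
  rw [← hs3.tsum_eq, tsum_fintype, Finset.sum_mul]
  refine Finset.sum_congr rfl fun r _ => ?_
  rw [hinner]
  generalize (-I * (c ^ 2 * δ)) ^ (1 / 2 : ℂ) = w at hpow ⊢
  rw [mul_assoc, mul_right_comm (1 / w), one_div, inv_mul_cancel₀ hpow, one_mul]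

lemma theta_limit {α : Type*} {F : Filter α} (a : ℤ) (c : ℕ) (hc : 0 < c) (hac : Even (a * c))
    (δ : α → ℂ) (hδ : ∀ᶠ t in F, 0 < (δ t).im)
    (h : Tendsto (fun t => (-1 / δ t).im) F atTop) :
    Tendsto (fun t => jacobiTheta ((a : ℂ) / c + δ t) * (-I * (c ^ 2 * δ t)) ^ (1 / 2 : ℂ)) F
      (𝓝 (∑ r ∈ Finset.range c, cexp (Real.pi * I * a * (r : ℂ) ^ 2 / c))) := by
  rw [← Fin.sum_univ_eq_sum_range (fun r => cexp (Real.pi * I * a * (r : ℂ) ^ 2 / c))]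
  have : Tendsto (fun t => ∑ r : Fin c, cexp (Real.pi * I * a * ((r : ℕ) : ℂ) ^ 2 / c) *
        jacobiTheta₂ ((((r : ℕ) : ℝ) / c : ℝ) : ℂ) (-1 / (c ^ 2 * δ t))) F
        (𝓝 (∑ r : Fin c, cexp (Real.pi * I * a * ((r : ℕ) : ℂ) ^ 2 / c))) := by
    refine tendsto_finsetSum _ fun r _ => ?_
    have h1 : Tendsto (fun t => (-1 / ((c : ℂ) ^ 2 * δ t)).im) F atTop := by
      have e : ∀ t, (-1 / ((c : ℂ) ^ 2 * δ t)).im = ((c : ℝ) ^ 2)⁻¹ * (-1 / δ t).im := by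
        intro t
        rw [← im_ofReal_mul]
        congr 1
        push_cast
        rw [← div_div, div_right_comm]; ring
      simp only [e]
      exact h.const_mul_atTop (by positivity)
    have h2 := (theta2_tendsto_one (((r : ℕ) : ℝ) / c) _ h1).const_mul
      (cexp (Real.pi * I * a * ((r : ℕ) : ℂ) ^ 2 / c))
    rw [mul_one] at h2
    exact h2
  refine this.congr' ?_
  filter_upwards [hδ] with t ht
  exact (theta_decomp a c hc hac _ ht).symm

lemma real_mul_cpow {r : ℝ} (hr : 0 < r) {x : ℂ} (hx : x ≠ 0) (s : ℂ) :
    ((r : ℂ) * x) ^ s = (r : ℂ) ^ s * x ^ s := by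
  have hr' : (r : ℂ) ≠ 0 := by exact_mod_cast hr.ne'
  rw [cpow_def_of_ne_zero (mul_ne_zero hr' hx), cpow_def_of_ne_zero hr', cpow_def_of_ne_zero hx,
    log_ofReal_mul hr hx, ← Complex.exp_add, ofReal_log hr.le, add_mul]

lemma landsberg_schaar (a c : ℕ) (ha : 0 < a) (hc : 0 < c) (hac : Even (a * c)) :
    ∑ r ∈ Finset.range c, cexp (Real.pi * I * (a : ℤ) * (r : ℂ) ^ 2 / c) =
      (∑ r ∈ Finset.range a, cexp (Real.pi * I * (-c : ℤ) * (r : ℂ) ^ 2 / a)) *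
        ((Real.sqrt (c / a) : ℂ) * cexp (Real.pi * I / 4)) := by
  have ha0 : (a : ℂ) ≠ 0 := by exact_mod_cast ha.ne'
  have hc0 : (c : ℂ) ≠ 0 := by exact_mod_cast hc.ne'
  have haR : (0 : ℝ) < a := by exact_mod_cast ha
  have hcR : (0 : ℝ) < c := by exact_mod_cast hc
  let τ : ℝ → ℂ := fun t => ((a : ℤ) : ℂ) / c + I * t
  let δ' : ℝ → ℂ := fun t => c * (I * t) / (a * τ t)
  have hτim : ∀ t, (τ t).im = t := by
    intro t
    have : τ t = ((a / c : ℝ) : ℂ) + I * t := by simp [τ]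
    rw [this]; simp
  have hτ0 : ∀ t, 0 < t → τ t ≠ 0 := by
    intro t ht h
    have := hτim t
    rw [h] at this; simp at this; linarith
  have hδ' : ∀ t, 0 < t → ((-c : ℤ) : ℂ) / a + δ' t = -1 / τ t := by
    intro t ht
    have h0 := hτ0 t ht
    have e : c * (I * t) = c * τ t - a := by simp only [τ]; push_cast; field_simp; ring
    simp only [δ']
    rw [e]
    push_cast
    field_simp
    ring
  have hpos : ∀ᶠ t : ℝ in 𝓝[>] 0, 0 < t := eventually_mem_nhdsWithin
  have L1 := theta_limit (F := 𝓝[>] (0 : ℝ)) (a : ℤ) c hc (by exact_mod_cast hac)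
    (fun t => I * t) (by filter_upwards [hpos] with t ht; simpa using ht) (by
      refine tendsto_inv_nhdsGT_zero.congr' ?_
      filter_upwards [hpos] with t ht
      have : (-1 / (I * t) : ℂ) = ((t⁻¹ : ℝ) : ℂ) * I := by
        have : (t : ℂ) ≠ 0 := by exact_mod_cast ht.ne'
        push_cast; field_simp; simp
      rw [this, im_ofReal_mul]; simp)
  have L2 := theta_limit (F := 𝓝[>] (0 : ℝ)) (-c : ℤ) a ha
    (by rw [neg_mul, mul_comm]; exact (show Even ((a : ℤ) * c) by exact_mod_cast hac).neg) δ' (by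
      filter_upwards [hpos] with t ht
      have e : δ' t = -1 / τ t + ((c / a : ℝ) : ℂ) := by
        rw [← hδ' t ht]; push_cast; ring
      rw [e, add_im, ofReal_im, add_zero, neg_div, neg_im, one_div, inv_im, hτim]
      have := normSq_pos.mpr (hτ0 t ht)
      rw [neg_div, neg_neg]; positivity) (by
      have := tendsto_inv_nhdsGT_zero (𝕜 := ℝ)
      refine (this.const_mul_atTop (r := (a / c : ℝ) ^ 2) (by positivity)).congr' ?_
      filter_upwards [hpos] with t ht
      have h0 := hτ0 t ht
      have : (-1 / δ' t : ℂ) = (((a / c : ℝ) ^ 2 * t⁻¹ : ℝ) : ℂ) * I + ((-(a / c) : ℝ) : ℂ) := by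
        have h1 : (t : ℂ) ≠ 0 := by exact_mod_cast ht.ne'
        have e : -1 / δ' t = - (a * τ t) / (c * (I * t)) := by
          simp only [δ']; field_simp
        rw [e]
        simp only [τ]
        push_cast
        field_simp
        ring_nf
        simp only [I_sq]; ring
      rw [this, add_im, im_ofReal_mul, ofReal_im]; simp)
  have hτlim : Tendsto τ (𝓝[>] 0) (𝓝 (((a / c : ℝ)) : ℂ)) := by
    have : Continuous τ := by fun_prop
    have h2 := (this.tendsto 0).mono_left (nhdsWithin_le_nhds (s := Set.Ioi 0))
    simpa [τ] using h2
  have hq : 0 < (a / c : ℝ) := by positivity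
  have hq' : 0 < (c / a : ℝ) := by positivity
  have hI : (-I) ^ (1 / 2 : ℂ) = cexp (-(Real.pi * I / 4)) := by
    rw [cpow_def_of_ne_zero (by simp), log_neg_I]; congr 1; ring
  have hG : Tendsto (fun t => ((c / a : ℝ) : ℂ) ^ (1 / 2 : ℂ) /
      ((-I * τ t) ^ (1 / 2 : ℂ) * ((τ t)⁻¹) ^ (1 / 2 : ℂ))) (𝓝[>] 0)
      (𝓝 ((Real.sqrt (c / a) : ℂ) * cexp (Real.pi * I / 4))) := by
    have l1 : Tendsto (fun t => (-I * τ t) ^ (1 / 2 : ℂ)) (𝓝[>] 0)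
        (𝓝 ((-I * ((a / c : ℝ) : ℂ)) ^ (1 / 2 : ℂ))) := by
      refine (hτlim.const_mul (-I)).cpow tendsto_const_nhds ?_
      right
      rw [mul_comm, im_ofReal_mul]; simp [ha.ne', hc.ne']
    have l2 : Tendsto (fun t => ((τ t)⁻¹) ^ (1 / 2 : ℂ)) (𝓝[>] 0)
        (𝓝 ((((a / c : ℝ) : ℂ)⁻¹) ^ (1 / 2 : ℂ))) := by
      refine (hτlim.inv₀ (by exact_mod_cast hq.ne')).cpow tendsto_const_nhds ?_
      rw [← ofReal_inv]
      exact ofReal_mem_slitPlane.mpr (by positivity)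
    have e : (-I * ((a / c : ℝ) : ℂ)) ^ (1 / 2 : ℂ) * (((a / c : ℝ) : ℂ)⁻¹) ^ (1 / 2 : ℂ)
        = cexp (-(Real.pi * I / 4)) := by
      have hne : ((a / c : ℝ) : ℂ) ≠ 0 := by exact_mod_cast hq.ne'
      rw [mul_comm (-I), real_mul_cpow hq (by simp), hI, mul_right_comm,
        ← real_mul_cpow hq (inv_ne_zero hne), mul_inv_cancel₀ hne, one_cpow, one_mul]
    have l3 := (tendsto_const_nhds (x := ((c / a : ℝ) : ℂ) ^ (1 / 2 : ℂ))).div (l1.mul l2)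
      (by rw [e]; exact Complex.exp_ne_zero _)
    rw [e, Complex.exp_neg, div_inv_eq_mul] at l3
    have e2 : (Real.sqrt (c / a) : ℂ) = ((c / a : ℝ) : ℂ) ^ (1 / 2 : ℂ) := by
      rw [Real.sqrt_eq_rpow, ofReal_cpow hq'.le]; simp
    rw [e2]
    exact l3
  refine tendsto_nhds_unique L1 ((L2.mul hG).congr' ?_)
  filter_upwards [hpos] with t ht
  have h0 := hτ0 t ht
  rw [hδ' t ht]
  have hact : 0 < (a * c * t : ℝ) := by positivity
  have e1 : -I * ((a : ℂ) ^ 2 * δ' t) = ((a * c * t : ℝ) : ℂ) * (τ t)⁻¹ := by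
    simp only [δ']; push_cast; field_simp; simp only [I_sq]; ring
  have e2 : -I * ((c : ℂ) ^ 2 * (I * t)) = ((c / a : ℝ) : ℂ) * ((a * c * t : ℝ) : ℂ) := by
    push_cast; field_simp; simp only [I_sq]; ring
  have hfe := jacobiTheta₂_functional_equation 0 (τ t)
  simp only [zero_div, ← jacobiTheta_eq_jacobiTheta₂] at hfe
  have hne : ((a * c * t : ℝ) : ℂ) ≠ 0 := by exact_mod_cast hact.ne'
  rw [e1, e2, real_mul_cpow hact (inv_ne_zero h0), real_mul_cpow hq' hne]
  change _ = jacobiTheta (τ t) * _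
  rw [hfe]
  have n1 : (-I * τ t) ^ (1 / 2 : ℂ) ≠ 0 := by
    rw [Ne, cpow_eq_zero_iff, not_and_or]; left; simp [h0]
  have n2 : ((τ t)⁻¹) ^ (1 / 2 : ℂ) ≠ 0 := by
    rw [Ne, cpow_eq_zero_iff, not_and_or]; left; simp [h0]
  generalize (-I * τ t) ^ (1 / 2 : ℂ) = u at *
  generalize ((τ t)⁻¹) ^ (1 / 2 : ℂ) = v at *
  generalize ((c / a : ℝ) : ℂ) ^ (1 / 2 : ℂ) = w at *
  generalize ((a * c * t : ℝ) : ℂ) ^ (1 / 2 : ℂ) = y at *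
  generalize jacobiTheta (-1 / τ t) = z at *
  simp
  field_simp

lemma three_sum (N : ℕ) (h : ¬ 3 ∣ N) :
    ∑ r ∈ Finset.range 3, cexp (Real.pi * I * (-(2 * N : ℕ) : ℤ) * (r : ℂ) ^ 2 / (3 : ℕ)) =
      -I * Real.sqrt 3 * (legendreSym 3 (N : ℤ) : ℂ) := by
  have hs : cexp (2 * Real.pi * I / 3) = -1 / 2 + Real.sqrt 3 / 2 * I := by
    have : (2 * Real.pi * I / 3 : ℂ) = ((Real.pi - Real.pi / 3 : ℝ) : ℂ) * I := by
      push_cast; ring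
    rw [this, exp_mul_I, ← ofReal_cos, ← ofReal_sin, Real.cos_pi_sub, Real.sin_pi_sub,
      Real.cos_pi_div_three, Real.sin_pi_div_three]
    push_cast; ring
  have hs' : cexp (-(2 * Real.pi * I / 3)) = -1 / 2 - Real.sqrt 3 / 2 * I := by
    have : (-(2 * Real.pi * I / 3) : ℂ) = ((-(Real.pi - Real.pi / 3) : ℝ) : ℂ) * I := by
      push_cast; ring
    rw [this, exp_mul_I, ← ofReal_cos, ← ofReal_sin, Real.cos_neg, Real.sin_neg, Real.cos_pi_sub,
      Real.sin_pi_sub, Real.cos_pi_div_three, Real.sin_pi_div_three]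
    push_cast; ring
  have hper : ∀ (x y : ℂ) (n : ℤ), x = y + n * (2 * Real.pi * I) → cexp x = cexp y :=
    fun x y n h => Complex.exp_eq_exp_iff_exists_int.mpr ⟨n, h⟩
  simp only [Finset.sum_range_succ, Finset.sum_range_zero]
  have hN : N % 3 = 1 ∨ N % 3 = 2 := by omega
  rcases hN with hN | hN
  · obtain ⟨k, rfl⟩ : ∃ k, N = 3 * k + 1 := ⟨N / 3, by omega⟩
    have hl : legendreSym 3 ((3 * k + 1 : ℕ) : ℤ) = 1 := by
      rw [legendreSym.mod]
      have : (((3 * k + 1 : ℕ) : ℤ) % (3 : ℕ)) = 1 := by omega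
      rw [this]; decide
    rw [hl, hper (_ * ((1 : ℕ) : ℂ) ^ 2 / _) (-(2 * Real.pi * I / 3)) (-k : ℤ) (by push_cast; ring),
      hper (_ * ((2 : ℕ) : ℂ) ^ 2 / _) (-(2 * Real.pi * I / 3)) (-4 * k - 1 : ℤ) (by push_cast; ring), hs']
    simp
    ring
  · obtain ⟨k, rfl⟩ : ∃ k, N = 3 * k + 2 := ⟨N / 3, by omega⟩
    have hl : legendreSym 3 ((3 * k + 2 : ℕ) : ℤ) = -1 := by
      rw [legendreSym.mod]
      have : (((3 * k + 2 : ℕ) : ℤ) % (3 : ℕ)) = 2 := by omega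
      rw [this]; decide
    rw [hl, hper (_ * ((1 : ℕ) : ℂ) ^ 2 / _) (2 * Real.pi * I / 3) (-k - 1 : ℤ) (by push_cast; ring),
      hper (_ * ((2 : ℕ) : ℂ) ^ 2 / _) (2 * Real.pi * I / 3) (-4 * k - 3 : ℤ) (by push_cast; ring), hs]
    simp
    ring

theorem gauss_sum_three_eq_legendre (p : ℕ) (hp : p.Prime) (hodd : Odd p) (hp5 : 5 ≤ p)
    (r : ℕ) (hr : 1 ≤ r) :
    Complex.exp (Real.pi * Complex.I / 4) * (1 / (Real.sqrt (2 * (p : ℝ) ^ r) : ℂ)) *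
        ∑ x ∈ Finset.range (2 * p ^ r),
          Complex.exp (2 * Real.pi * Complex.I * (3 * (x : ℂ) ^ 2 / (4 * (p : ℂ) ^ r))) =
      (legendreSym 3 ((p : ℤ) ^ r) : ℂ) := by
  have hp0 : 0 < p := by omega
  have h3 : ¬ 3 ∣ p ^ r := by
    intro h
    have := (Nat.prime_dvd_prime_iff_eq Nat.prime_three hp).mp (Nat.prime_three.dvd_of_dvd_pow h)
    omega
  have hLS := landsberg_schaar 3 (2 * p ^ r) (by norm_num) (by positivity)
    ⟨3 * p ^ r, by ring⟩
  rw [three_sum _ h3] at hLS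
  have hsum : ∑ x ∈ Finset.range (2 * p ^ r),
          cexp (2 * Real.pi * I * (3 * (x : ℂ) ^ 2 / (4 * (p : ℂ) ^ r))) =
      ∑ x ∈ Finset.range (2 * p ^ r),
        cexp (Real.pi * I * ((3 : ℕ) : ℤ) * (x : ℂ) ^ 2 / (2 * p ^ r : ℕ)) := by
    refine Finset.sum_congr rfl fun x _ => ?_
    congr 1
    have : (p : ℂ) ≠ 0 := by exact_mod_cast hp0.ne'
    push_cast
    field_simp
    ring
  rw [hsum, hLS]
  have hsq : (Real.sqrt (((2 * p ^ r : ℕ) : ℝ) / (3 : ℕ)) : ℂ) =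
      Real.sqrt (2 * (p : ℝ) ^ r) / Real.sqrt 3 := by
    rw [Real.sqrt_div (by positivity)]; push_cast; rfl
  have n1 : (Real.sqrt (2 * (p : ℝ) ^ r) : ℂ) ≠ 0 := by
    have : 0 < Real.sqrt (2 * (p : ℝ) ^ r) := Real.sqrt_pos.mpr (by positivity)
    exact_mod_cast this.ne'
  have n2 : (Real.sqrt 3 : ℂ) ≠ 0 := by
    have : 0 < Real.sqrt 3 := Real.sqrt_pos.mpr (by positivity)
    exact_mod_cast this.ne'
  have hE : cexp (Real.pi * I / 4) * cexp (Real.pi * I / 4) = I := by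
    rw [← Complex.exp_add, show (Real.pi * I / 4 + Real.pi * I / 4 : ℂ) = Real.pi / 2 * I by ring,
      exp_pi_div_two_mul_I]
  rw [hsq]
  have hc : ((p ^ r : ℕ) : ℤ) = (p : ℤ) ^ r := by push_cast; rfl
  rw [hc]
  generalize (Real.sqrt (2 * (p : ℝ) ^ r) : ℂ) = A at *
  generalize (Real.sqrt 3 : ℂ) = B at *
  generalize cexp (Real.pi * I / 4) = E at *
  generalize (legendreSym 3 ((p : ℤ) ^ r) : ℂ) = M at *
  calc E * (1 / A) * (-I * B * M * (A / B * E)) = -I * (E * E) * M := by field_simp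
    _ = M := by rw [hE]; simp
end
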